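/- arXiv:1109.6214 — 2 statements merged into one kernel-verified Lean document; each statement's English description precedes it below -/
import Mathlib

section
/- Let μ > 0 be real. Then there exist T > 0 and a nonconstant differentiable function (x, y) : ℝ → ℝ² that is T-periodic and satisfies x'(t) = μ·(x(t) - x(t)³/3 - y(t)) and y'(t) = x(t)/μ for all t. Moreover this periodic orbit is unique: any two nonconstant periodic solutions of this system have the same image in ℝ². -/
open Set Filter Topology Metric
open scoped NNReal

/-- The van der Pol vector field in Liénard form. -/
noncomputable def vdpField (μ : ℝ) (p : ℝ × ℝ) : ℝ × ℝ :=
  (μ * (p.1 - p.1 ^ 3 / 3 - p.2), p.1 / μ)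

/-- A curve solving the van der Pol system for nonnegative times. -/
def IsForwardSol (μ : ℝ) (p : ℝ → ℝ × ℝ) : Prop :=
  ∀ t, 0 ≤ t → HasDerivAt p (vdpField μ (p t)) t

lemma le_of_hasDerivAt_nonneg {f f' : ℝ → ℝ} {a b : ℝ} (hab : a ≤ b)
    (hf : ∀ t ∈ Icc a b, HasDerivAt f (f' t) t) (hf' : ∀ t ∈ Ioo a b, 0 ≤ f' t) :
    f a ≤ f b := by
  refine monotoneOn_of_deriv_nonneg (convex_Icc a b) (HasDerivAt.continuousOn hf)
    (fun t ht => ?_) (fun t ht => ?_) (left_mem_Icc.2 hab) (right_mem_Icc.2 hab) hab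
  · exact (hf t (interior_subset ht)).differentiableAt.differentiableWithinAt
  · rw [(hf t (interior_subset ht)).deriv]
    exact hf' t (by simpa using ht)

lemma lt_of_hasDerivAt_pos {f f' : ℝ → ℝ} {a b : ℝ} (hab : a < b)
    (hf : ∀ t ∈ Icc a b, HasDerivAt f (f' t) t) (hf' : ∀ t ∈ Ioo a b, 0 < f' t) :
    f a < f b := by
  refine strictMonoOn_of_deriv_pos (convex_Icc a b) (HasDerivAt.continuousOn hf)
    (fun t ht => ?_) (left_mem_Icc.2 hab.le) (right_mem_Icc.2 hab.le) hab
  rw [(hf t (interior_subset ht)).deriv]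
  exact hf' t (by simpa using ht)

lemma contDiff_vdpField (μ : ℝ) : ContDiff ℝ 1 (vdpField μ) := by
  unfold vdpField
  fun_prop

lemma exists_lipschitzOnWith_vdpField (μ R : ℝ) :
    ∃ K, LipschitzOnWith K (vdpField μ) (closedBall 0 R) :=
  (contDiff_vdpField μ).contDiffOn.exists_lipschitzOnWith one_ne_zero
    (convex_closedBall _ _) (isCompact_closedBall _ _)

lemma eqOn_Icc_of_vdpField {μ a b : ℝ} {p q : ℝ → ℝ × ℝ}
    (hp : ∀ t ∈ Icc a b, HasDerivAt p (vdpField μ (p t)) t)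
    (hq : ∀ t ∈ Icc a b, HasDerivAt q (vdpField μ (q t)) t) (h : p a = q a) :
    EqOn p q (Icc a b) := by
  have hpc : ContinuousOn p (Icc a b) := HasDerivAt.continuousOn hp
  have hqc : ContinuousOn q (Icc a b) := HasDerivAt.continuousOn hq
  obtain ⟨R, hR⟩ := ((isCompact_Icc.image_of_continuousOn hpc).union
    (isCompact_Icc.image_of_continuousOn hqc)).isBounded.subset_closedBall 0
  obtain ⟨K, hK⟩ := exists_lipschitzOnWith_vdpField μ R
  exact ODE_solution_unique_of_mem_Icc_right (v := fun _ => vdpField μ)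
    (s := fun _ => closedBall 0 R) (fun _ _ => hK) hpc
    (fun t ht => (hp t (Ico_subset_Icc_self ht)).hasDerivWithinAt)
    (fun t ht => hR (.inl (mem_image_of_mem p (Ico_subset_Icc_self ht)))) hqc
    (fun t ht => (hq t (Ico_subset_Icc_self ht)).hasDerivWithinAt)
    (fun t ht => hR (.inr (mem_image_of_mem q (Ico_subset_Icc_self ht)))) h

namespace IsForwardSol

variable {μ : ℝ} {p q : ℝ → ℝ × ℝ}

lemma shift (hp : IsForwardSol μ p) {s : ℝ} (hs : 0 ≤ s) :
    IsForwardSol μ fun t => p (t + s) := fun t ht =>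
  (hp (t + s) (add_nonneg ht hs)).comp_add_const t s

lemma neg (hp : IsForwardSol μ p) : IsForwardSol μ fun t => -p t := fun t ht => by
  refine (hp t ht).neg.congr_deriv ?_
  ext <;> simp [vdpField] <;> ring

lemma eq_of_eq (hp : IsForwardSol μ p) (hq : IsForwardSol μ q) (h : p 0 = q 0) {t : ℝ}
    (ht : 0 ≤ t) : p t = q t :=
  eqOn_Icc_of_vdpField (fun s hs => hp s hs.1) (fun s hs => hq s hs.1) h ⟨ht, le_rfl⟩

lemma hasDerivAt_fst (hp : IsForwardSol μ p) {t : ℝ} (ht : 0 ≤ t) :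
    HasDerivAt (fun s => (p s).1) (μ * ((p t).1 - (p t).1 ^ 3 / 3 - (p t).2)) t :=
  (hp t ht).fst

lemma hasDerivAt_snd (hp : IsForwardSol μ p) {t : ℝ} (ht : 0 ≤ t) :
    HasDerivAt (fun s => (p s).2) ((p t).1 / μ) t :=
  (hp t ht).snd

end IsForwardSol

lemma hasDerivAt_energy {μ : ℝ} (hμ : μ ≠ 0) {p : ℝ → ℝ × ℝ} {t : ℝ}
    (h : HasDerivAt p (vdpField μ (p t)) t) :
    HasDerivAt (fun s => (p s).1 ^ 2 / 2 + μ ^ 2 * (p s).2 ^ 2 / 2)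
      (μ * ((p t).1 ^ 2 * (1 - (p t).1 ^ 2 / 3))) t := by
  have h1 : HasDerivAt (fun s => (p s).1) (μ * ((p t).1 - (p t).1 ^ 3 / 3 - (p t).2)) t := h.fst
  have h2 : HasDerivAt (fun s => (p s).2) ((p t).1 / μ) t := h.snd
  refine (((h1.pow 2).div_const 2).add
    (((h2.pow 2).const_mul (μ ^ 2)).div_const 2)).congr_deriv ?_
  field_simp
  ring

/-- Solutions exist on every bounded interval of nonnegative times, as the energy grows at most
linearly. -/
lemma exists_sol_Ico {μ : ℝ} (hμ : 0 < μ) (p₀ : ℝ × ℝ) {N : ℝ} (hN : 0 < N) :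
    ∃ p : ℝ → ℝ × ℝ, p 0 = p₀ ∧ ∀ t ∈ Ico 0 N, HasDerivAt p (vdpField μ (p t)) t := by
  set V : ℝ × ℝ → ℝ := fun q => q.1 ^ 2 / 2 + μ ^ 2 * q.2 ^ 2 / 2 with hV
  set M : ℝ := V p₀ + 3 * μ / 4 * N with hM
  have hV0 : 0 ≤ V p₀ := by positivity
  have hM0 : 0 < M := by positivity
  have hbound : ∃ R : ℝ, 0 < R ∧ ∀ q, V q ≤ M → q ∈ closedBall (0 : ℝ × ℝ) R := by
    refine ⟨(2 * M + 1) + (2 * M / μ ^ 2 + 1), by positivity, fun q hq => ?_⟩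
    replace hq : q.1 ^ 2 / 2 + μ ^ 2 * q.2 ^ 2 / 2 ≤ M := hq
    have h1 : |q.1| ≤ 2 * M + 1 := by
      rw [abs_le]
      have : 0 ≤ μ ^ 2 * q.2 ^ 2 / 2 := by positivity
      constructor <;> nlinarith
    have h2 : |q.2| ≤ 2 * M / μ ^ 2 + 1 := by
      have : q.2 ^ 2 ≤ 2 * M / μ ^ 2 := by
        rw [le_div_iff₀ (by positivity)]
        nlinarith [sq_nonneg q.1]
      rw [abs_le]
      constructor <;> nlinarith
    have h3 : 0 ≤ 2 * M / μ ^ 2 := by positivity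
    rw [mem_closedBall_zero_iff, Prod.norm_def, Real.norm_eq_abs, Real.norm_eq_abs]
    exact max_le (by linarith) (by linarith)
  obtain ⟨R, hR, hball⟩ := hbound
  let χ : ContDiffBump (0 : ℝ × ℝ) := ⟨R, R + 1, hR, by linarith⟩
  set G : ℝ × ℝ → ℝ × ℝ := fun q => χ q • vdpField μ q with hG
  have hGsmooth : ContDiff ℝ 1 G := χ.contDiff.smul (contDiff_vdpField μ)
  have hGsupp : HasCompactSupport G := χ.hasCompactSupport.smul_right
  obtain ⟨K, hK⟩ := hGsmooth.lipschitzWith_of_hasCompactSupport hGsupp one_ne_zero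
  obtain ⟨C, hC⟩ := hGsupp.exists_bound_of_continuous hGsmooth.continuous
  have hC0 : 0 ≤ C := (norm_nonneg _).trans (hC 0)
  have hpl : IsPicardLindelof (fun _ => G) (tmin := -1) (tmax := N)
      ⟨0, by constructor <;> linarith⟩ p₀ (C.toNNReal * (N + 1).toNNReal) 0 C.toNNReal K :=
    { lipschitzOnWith := fun _ _ => hK.lipschitzOnWith
      continuousOn := fun _ _ => continuousOn_const
      norm_le := fun _ _ q _ => by simpa [hC0] using hC q
      mul_max_le := by
        have : max N 1 ≤ N + 1 := max_le (by linarith) (by linarith)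
        simp [hC0, (by linarith : 0 ≤ N + 1)]
        gcongr }
  obtain ⟨p, hp0, hp⟩ := hpl.exists_eq_forall_mem_Icc_hasDerivWithinAt₀
  have hpG : ∀ t ∈ Ico 0 N, HasDerivAt p (G (p t)) t := fun t ht =>
    (hp t ⟨by linarith [ht.1], ht.2.le⟩).hasDerivAt (Icc_mem_nhds (by linarith [ht.1]) ht.2)
  have hVp : ∀ t ∈ Ico 0 N, HasDerivAt (fun s => V (p s))
      (χ (p t) * (μ * ((p t).1 ^ 2 * (1 - (p t).1 ^ 2 / 3)))) t := fun t ht => by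
    have h1 : HasDerivAt (fun s => (p s).1)
      (χ (p t) * (μ * ((p t).1 - (p t).1 ^ 3 / 3 - (p t).2))) t := (hpG t ht).fst
    have h2 : HasDerivAt (fun s => (p s).2) (χ (p t) * ((p t).1 / μ)) t := (hpG t ht).snd
    refine (((h1.pow 2).div_const 2).add
      (((h2.pow 2).const_mul (μ ^ 2)).div_const 2)).congr_deriv ?_
    field_simp
    ring
  refine ⟨p, hp0, fun t ht => ?_⟩
  have hle : V (p t) ≤ M := by
    have := le_of_hasDerivAt_nonneg (f := fun s => 3 * μ / 4 * s - V (p s)) ht.1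
      (fun s hs => (((hasDerivAt_id s).const_mul (3 * μ / 4)).sub
        (hVp s ⟨hs.1, hs.2.trans_lt ht.2⟩))) (fun s hs => by
        have h1 : (p s).1 ^ 2 * (1 - (p s).1 ^ 2 / 3) ≤ 3 / 4 := by
          nlinarith [sq_nonneg ((p s).1 ^ 2 - 3 / 2)]
        have h2 : χ (p s) * (μ * ((p s).1 ^ 2 * (1 - (p s).1 ^ 2 / 3))) ≤ 1 * (μ * (3 / 4)) :=
          (mul_le_mul_of_nonneg_left (mul_le_mul_of_nonneg_left h1 hμ.le) χ.nonneg).trans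
            (mul_le_mul_of_nonneg_right χ.le_one (by positivity))
        linarith)
    have h0 : V (p 0) = V p₀ := by rw [hp0]
    have h1 : 3 * μ / 4 * t ≤ 3 * μ / 4 * N := mul_le_mul_of_nonneg_left ht.2.le (by positivity)
    simp only [mul_zero] at this
    linarith
  have := hpG t ht
  rwa [hG, show (fun q => χ q • vdpField μ q) (p t) = vdpField μ (p t) by
    simp [χ.one_of_mem_closedBall (hball _ hle)]] at this

lemma exists_isForwardSol {μ : ℝ} (hμ : 0 < μ) (p₀ : ℝ × ℝ) :
    ∃ p, IsForwardSol μ p ∧ p 0 = p₀ := by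
  choose P hP0 hP using fun n : ℕ => exists_sol_Ico hμ p₀ (N := n + 1) (by positivity)
  have key : ∀ m n : ℕ, ∀ t : ℝ, 0 ≤ t → t < m + 1 → t < n + 1 → P m t = P n t :=
    fun m n t ht hm hn => eqOn_Icc_of_vdpField
      (fun s hs => hP m s ⟨hs.1, hs.2.trans_lt hm⟩)
      (fun s hs => hP n s ⟨hs.1, hs.2.trans_lt hn⟩) ((hP0 m).trans (hP0 n).symm) ⟨ht, le_rfl⟩
  refine ⟨fun t => P ⌊t⌋₊ t, fun t ht => ?_, by simp [hP0]⟩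
  have hlt : t < ⌊t⌋₊ + 1 := Nat.lt_floor_add_one t
  rcases ht.eq_or_lt with rfl | ht
  · have h := hP 0 0 ⟨le_rfl, by simp⟩
    simp only [Nat.floor_zero]
    refine h.congr_of_eventuallyEq ?_
    filter_upwards [Iio_mem_nhds (zero_lt_one' ℝ)] with s hs
    rw [Nat.floor_eq_zero.2 hs]
  · set n := ⌊t⌋₊ with hn
    refine (hP n t ⟨ht.le, hlt⟩).congr_of_eventuallyEq ?_
    filter_upwards [Ioo_mem_nhds ht hlt] with s hs
    exact key _ _ s hs.1.le (Nat.lt_floor_add_one s) hs.2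

lemma le_of_hasDerivAt_pos_of_eq {f f' : ℝ → ℝ} {a b c : ℝ}
    (hf : ∀ t ∈ Icc a b, HasDerivAt f (f' t) t) (ha : c ≤ f a)
    (hc : ∀ t ∈ Ico a b, f t = c → 0 < f' t) {t : ℝ} (ht : t ∈ Icc a b) : c ≤ f t := by
  have := image_le_of_deriv_right_lt_deriv_boundary (f := fun t => -f t) (f' := fun t => -f' t)
    (B := fun _ => -c) (B' := fun _ => 0) (a := a) (b := b)
    (HasDerivAt.continuousOn fun t ht => (hf t ht).fun_neg)
    (fun t ht => (hf t (Ico_subset_Icc_self ht)).fun_neg.hasDerivWithinAt) (neg_le_neg ha)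
    (fun _ => hasDerivAt_const _ _)
    (fun t ht h => neg_neg_of_pos (hc t ht (neg_inj.1 h))) ht
  exact neg_le_neg_iff.1 this

lemma StrictMonoOn.exists_continuousOn_rightInverse {f : ℝ → ℝ} {a b : ℝ} (hab : a ≤ b)
    (hf : ContinuousOn f (Icc a b)) (hmono : StrictMonoOn f (Icc a b)) :
    ∃ g : ℝ → ℝ, ContinuousOn g (Icc (f a) (f b)) ∧
      ∀ y ∈ Icc (f a) (f b), g y ∈ Icc a b ∧ f (g y) = y := by
  have himg : f '' Icc a b = Icc (f a) (f b) := by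
    refine subset_antisymm ?_ (intermediate_value_Icc hab hf)
    rintro _ ⟨t, ht, rfl⟩
    exact ⟨hmono.monotoneOn (left_mem_Icc.2 hab) ht ht.1,
      hmono.monotoneOn ht (right_mem_Icc.2 hab) ht.2⟩
  have : OrdConnected (f '' Icc a b) := himg ▸ ordConnected_Icc
  let e := hmono.orderIso f (Icc a b)
  classical
  refine ⟨fun y => if h : y ∈ f '' Icc a b then e.symm ⟨y, h⟩ else 0, ?_, fun y hy => ?_⟩
  · rw [← himg, continuousOn_iff_continuous_domRestrict]
    convert continuous_subtype_val.comp e.symm.continuous using 1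
    ext y
    exact dif_pos y.2
  · rw [← himg] at hy
    simp only [hy, dite_true]
    exact ⟨(e.symm ⟨y, hy⟩).2, congrArg Subtype.val (e.apply_symm_apply ⟨y, hy⟩)⟩

namespace IsForwardSol

variable {μ : ℝ} {p : ℝ → ℝ × ℝ}

lemma snd_lt_snd (hμ : 0 < μ) (hp : IsForwardSol μ p) {s t : ℝ} (hs : 0 ≤ s) (hst : s < t)
    (hpos : ∀ u ∈ Ioo s t, 0 < (p u).1) : (p s).2 < (p t).2 :=
  lt_of_hasDerivAt_pos hst (fun _ hu => hp.hasDerivAt_snd (hs.trans hu.1))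
    fun u hu => div_pos (hpos u hu) hμ

lemma not_forall_fst_pos (hμ : 0 < μ) (hp : IsForwardSol μ p) :
    ¬ ∀ t, 0 < t → 0 < (p t).1 := by
  intro hpos
  have hmono : ∀ s t, 0 ≤ s → s < t → (p s).2 < (p t).2 := fun s t hs hst =>
    hp.snd_lt_snd hμ hs hst fun u hu => hpos u (hs.trans_lt hu.1)
  have hbdd : ∀ t, 0 < t → (p t).2 < 5 / 3 := by
    intro t₀ ht₀
    by_contra! h
    set T := (p t₀).1 / μ with hT
    have hT0 : 0 < T := div_pos (hpos t₀ ht₀) hμ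
    have := le_of_hasDerivAt_nonneg (f := fun s => -(p s).1 - μ * s) (a := t₀) (b := t₀ + T)
      (by linarith) (fun s hs => ((hp.hasDerivAt_fst (ht₀.le.trans hs.1)).neg.sub
        ((hasDerivAt_id s).const_mul μ))) (fun s hs => by
          have h1 := hpos s (ht₀.trans hs.1)
          have h2 := hmono t₀ s ht₀.le hs.1
          have h3 : (p s).1 - (p s).1 ^ 3 / 3 - (p s).2 ≤ -1 := by
            nlinarith [mul_nonneg (sq_nonneg ((p s).1 - 1)) (by linarith : 0 ≤ (p s).1 + 2)]
          nlinarith)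
    have h1 := hpos (t₀ + T) (by linarith)
    have h2 : μ * T = (p t₀).1 := by rw [hT]; field_simp
    simp only [mul_add] at this
    linarith
  by_cases hcase : ∃ t₁, 0 < t₁ ∧ 0 < (p t₁).2
  · obtain ⟨t₁, ht₁, hc⟩ := hcase
    set c := (p t₁).2 with hcdef
    set K := (p t₁).1 + μ ^ 2 * (5 / 3) with hK
    have hK0 : 0 < K := add_pos (hpos t₁ ht₁) (by positivity)
    set T := K / (μ * c) with hT
    have hT0 : 0 < T := by positivity
    have := le_of_hasDerivAt_nonneg (f := fun s => μ ^ 2 * (p s).2 - (p s).1 - μ * c * s)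
      (a := t₁) (b := t₁ + T) (by linarith) (fun s hs =>
        (((hp.hasDerivAt_snd (ht₁.le.trans hs.1)).const_mul (μ ^ 2)).sub
          (hp.hasDerivAt_fst (ht₁.le.trans hs.1))).sub ((hasDerivAt_id s).const_mul (μ * c)))
      (fun s hs => by
        have h1 := hpos s (ht₁.trans hs.1)
        have h2 := hmono t₁ s ht₁.le hs.1
        have h3 : μ ^ 2 * ((p s).1 / μ) - μ * ((p s).1 - (p s).1 ^ 3 / 3 - (p s).2) - μ * c * 1
            = μ * ((p s).1 ^ 3 / 3 + ((p s).2 - c)) := by field_simp; ring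
        rw [h3]
        have : 0 ≤ (p s).2 - c := by linarith
        positivity)
    have h1 := hpos (t₁ + T) (by linarith)
    have h2 := hbdd (t₁ + T) (by linarith)
    have h3 : μ * c * T = K := by rw [hT]; field_simp
    have h4 : μ ^ 2 * (p (t₁ + T)).2 ≤ μ ^ 2 * (5 / 3) := by gcongr
    have h5 : 0 < μ ^ 2 * c := by positivity
    simp only [mul_add] at this
    linarith
  · push Not at hcase
    have hneg : ∀ t, 0 < t → (p t).2 < 0 := fun t ht =>
      (hmono t (t + 1) ht.le (by linarith)).trans_le (hcase _ (by linarith))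
    set c := min (p 1).1 1 with hc
    have hc0 : 0 < c := lt_min (hpos 1 one_pos) one_pos
    have hc1 : c ≤ 1 := min_le_right _ _
    set T := -(p 1).2 * μ / c with hT
    have hT0 : 0 < T := div_pos (mul_pos (neg_pos.2 (hneg 1 one_pos)) hμ) hc0
    have hx : ∀ t ∈ Icc 1 (1 + T), c ≤ (p t).1 := fun t ht =>
      le_of_hasDerivAt_pos_of_eq (f := fun t => (p t).1)
        (fun s hs => hp.hasDerivAt_fst (zero_le_one.trans hs.1))
        (min_le_left _ _) (fun s hs h => by
          have h1 := hneg s (one_pos.trans_le hs.1)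
          have h2 : (p s).1 = c := h
          rw [h2]
          have : c ^ 3 ≤ c := by nlinarith [mul_pos hc0 hc0]
          exact mul_pos hμ (by linarith)) ht
    have := le_of_hasDerivAt_nonneg (f := fun s => (p s).2 - c / μ * s) (a := 1) (b := 1 + T)
      (by linarith) (fun s hs => (hp.hasDerivAt_snd (zero_le_one.trans hs.1)).sub
        ((hasDerivAt_id s).const_mul (c / μ))) (fun s hs => by
          have := hx s (Ioo_subset_Icc_self hs)
          rw [mul_one, sub_nonneg]
          gcongr)
    have h1 := hneg (1 + T) (by linarith)
    have h2 : c / μ * T = -(p 1).2 := by rw [hT]; field_simp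
    simp only [mul_add] at this
    linarith

lemma exists_fst_pos (hμ : 0 < μ) (hp : IsForwardSol μ p) {b : ℝ} (hb : 0 < b)
    (h0 : p 0 = (0, -b)) : ∃ ε > 0, ∀ t ∈ Ioo 0 ε, 0 < (p t).1 := by
  have hc : ContinuousAt (fun t => (p t).1 - (p t).1 ^ 3 / 3 - (p t).2) 0 := by
    have := (hp 0 le_rfl).continuousAt
    fun_prop
  have hev := hc.eventually (lt_mem_nhds (a := 0) (by simpa [h0] using hb))
  obtain ⟨ε, hε, h⟩ := Metric.eventually_nhds_iff.1 hev
  refine ⟨ε, hε, fun t ht => ?_⟩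
  have := lt_of_hasDerivAt_pos ht.1 (fun s hs => hp.hasDerivAt_fst hs.1) fun s hs =>
    mul_pos hμ (h (by rw [Real.dist_eq, sub_zero, abs_of_pos hs.1]; exact hs.2.trans ht.2))
  simpa [h0] using this

end IsForwardSol

/-- `p` starts at `(0, -b)`, runs through the half-plane `x > 0` and hits the line `x = 0` again
at time `τ`. -/
structure IsHalfTurn (μ b : ℝ) (p : ℝ → ℝ × ℝ) (τ : ℝ) : Prop where
  sol : IsForwardSol μ p
  init : p 0 = (0, -b)
  time_pos : 0 < τ
  fst_pos : ∀ t ∈ Ioo 0 τ, 0 < (p t).1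
  fst_eq_zero : (p τ).1 = 0

lemma exists_isHalfTurn {μ b : ℝ} (hμ : 0 < μ) (hb : 0 < b) : ∃ p τ, IsHalfTurn μ b p τ := by
  obtain ⟨p, hp, h0⟩ := exists_isForwardSol hμ (0, -b)
  obtain ⟨ε, hε, hpos⟩ := hp.exists_fst_pos hμ hb h0
  have hnot := hp.not_forall_fst_pos hμ
  push Not at hnot
  obtain ⟨t₁, ht₁, hx₁⟩ := hnot
  have hle : ε ≤ t₁ := by
    by_contra! h
    exact hx₁.not_gt (hpos t₁ ⟨ht₁, h⟩)
  have hcont : ContinuousOn (fun t => (p t).1) (Icc (ε / 2) t₁) :=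
    HasDerivAt.continuousOn fun t ht => hp.hasDerivAt_fst (by linarith [ht.1])
  have hcomp : IsCompact (Icc (ε / 2) t₁ ∩ (fun t => (p t).1) ⁻¹' Iic 0) :=
    isCompact_Icc.of_isClosed_subset (hcont.preimage_isClosed_of_isClosed isClosed_Icc isClosed_Iic)
      inter_subset_left
  obtain ⟨τ, ⟨hτ, hxτ⟩, hleast⟩ := hcomp.exists_isLeast ⟨t₁, ⟨by linarith, le_rfl⟩, hx₁⟩
  have hτ0 : 0 < τ := by linarith [hτ.1]
  have hfst : ∀ t ∈ Ioo 0 τ, 0 < (p t).1 := by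
    intro t ht
    rcases lt_or_ge t ε with h | h
    · exact hpos t ⟨ht.1, h⟩
    · by_contra! hx
      exact (hleast ⟨⟨by linarith, ht.2.le.trans hτ.2⟩, hx⟩).not_gt ht.2
  refine ⟨p, τ, hp, h0, hτ0, hfst, le_antisymm hxτ ?_⟩
  refine ge_of_tendsto ((hp.hasDerivAt_fst hτ0.le).continuousAt.tendsto.mono_left
    (nhdsWithin_le_nhds (s := Iio τ))) ?_
  filter_upwards [Ioo_mem_nhdsLT hτ0] with t ht using (hfst t ht).le

namespace IsHalfTurn

variable {μ b τ : ℝ} {p : ℝ → ℝ × ℝ}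

lemma strictMonoOn_snd (hμ : 0 < μ) (h : IsHalfTurn μ b p τ) :
    StrictMonoOn (fun t => (p t).2) (Icc 0 τ) := fun _ hs _ ht hst =>
  h.sol.snd_lt_snd hμ hs.1 hst fun u hu => h.fst_pos u ⟨hs.1.trans_lt hu.1, hu.2.trans_le ht.2⟩

lemma continuousOn (h : IsHalfTurn μ b p τ) : ContinuousOn p (Icc 0 τ) :=
  HasDerivAt.continuousOn fun t ht => h.sol t ht.1

lemma fst_nonneg (h : IsHalfTurn μ b p τ) {t : ℝ} (ht : t ∈ Icc 0 τ) : 0 ≤ (p t).1 := by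
  rcases ht.1.eq_or_lt with rfl | h0
  · simp [h.init]
  rcases ht.2.eq_or_lt with rfl | h1
  · exact h.fst_eq_zero.ge
  · exact (h.fst_pos t ⟨h0, h1⟩).le

lemma snd_nonneg (hμ : 0 < μ) (h : IsHalfTurn μ b p τ) : 0 ≤ (p τ).2 := by
  by_contra! hneg
  have hc : ContinuousAt (fun t => (p t).1 - (p t).1 ^ 3 / 3 - (p t).2) τ := by
    have := (h.sol τ h.time_pos.le).continuousAt
    fun_prop
  have hev := hc.eventually (lt_mem_nhds (a := 0) (by simpa [h.fst_eq_zero] using hneg))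
  obtain ⟨ε, hε, hball⟩ := Metric.eventually_nhds_iff.1 hev
  set s := max (τ - ε) (τ / 2) with hs
  have hτ := h.time_pos
  have hs0 : 0 < s := lt_max_of_lt_right (by linarith)
  have hsτ : s < τ := max_lt (by linarith) (by linarith)
  have hsε : τ - ε ≤ s := le_max_left _ _
  have := lt_of_hasDerivAt_pos hsτ (fun u hu => h.sol.hasDerivAt_fst (hs0.le.trans hu.1))
    fun u hu => mul_pos hμ (hball (by
      rw [Real.dist_eq, abs_of_neg (by linarith [hu.2])]
      linarith [hu.1]))
  rw [h.fst_eq_zero] at this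
  exact this.not_gt (h.fst_pos s ⟨hs0, hsτ⟩)

lemma remaining_eq {b' τ' : ℝ} {q : ℝ → ℝ × ℝ} (hp : IsHalfTurn μ b p τ)
    (hq : IsHalfTurn μ b' q τ') {s t : ℝ} (hs : s ∈ Ico 0 τ) (ht : t ∈ Ico 0 τ')
    (h : p s = q t) : p τ = q τ' := by
  have heq : ∀ u, 0 ≤ u → p (u + s) = q (u + t) := fun u hu =>
    (hp.sol.shift hs.1).eq_of_eq (hq.sol.shift ht.1) (by simpa using h) hu
  rcases lt_trichotomy (τ - s) (τ' - t) with hlt | heq' | hlt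
  · have h1 := heq (τ - s) (by linarith [hs.2])
    have h2 := hq.fst_pos (τ - s + t) ⟨by linarith [hs.2, ht.1], by linarith⟩
    rw [← h1, sub_add_cancel, hp.fst_eq_zero] at h2
    exact (lt_irrefl _ h2).elim
  · have h1 := heq (τ - s) (by linarith [hs.2])
    rwa [sub_add_cancel, heq', sub_add_cancel] at h1
  · have h1 := heq (τ' - t) (by linarith [ht.2])
    have h2 := hp.fst_pos (τ' - t + s) ⟨by linarith [hs.1, ht.2], by linarith⟩
    rw [h1, sub_add_cancel, hq.fst_eq_zero] at h2
    exact (lt_irrefl _ h2).elim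

/-- The half-return map is monotone, as orbits do not cross. -/
lemma snd_le_snd (hμ : 0 < μ) {b' τ' : ℝ} {q : ℝ → ℝ × ℝ} (hp : IsHalfTurn μ b p τ)
    (hq : IsHalfTurn μ b' q τ') (hb : 0 < b) (hbb' : b ≤ b') : (p τ).2 ≤ (q τ').2 := by
  rcases hbb'.eq_or_lt with rfl | hlt
  · rw [hp.remaining_eq hq ⟨le_rfl, hp.time_pos⟩ ⟨le_rfl, hq.time_pos⟩
      (hp.init.trans hq.init.symm)]
  by_contra! hcon
  have hq0 := hq.snd_nonneg hμ
  have hyp := hp.strictMonoOn_snd hμ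
  have hyq := hq.strictMonoOn_snd hμ
  have hp0 : (p 0).2 = -b := by rw [hp.init]
  have hq0' : (q 0).2 = -b' := by rw [hq.init]
  obtain ⟨g, hgc, hg⟩ := hyp.exists_continuousOn_rightInverse hp.time_pos.le hp.continuousOn.snd
  obtain ⟨t₀, ht₀, hyt₀⟩ := intermediate_value_Icc hq.time_pos.le hq.continuousOn.snd
    (show -b ∈ Icc (q 0).2 (q τ').2 from ⟨by linarith, by linarith⟩)
  have hyt₀ : (q t₀).2 = -b := hyt₀
  have ht₀pos : 0 < t₀ := by
    rcases ht₀.1.eq_or_lt with rfl | h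
    · linarith
    · exact h
  have ht₀lt : t₀ < τ' := by
    rcases ht₀.2.eq_or_lt with rfl | h
    · linarith
    · exact h
  have hsub : Icc t₀ τ' ⊆ Icc 0 τ' := Icc_subset_Icc_left ht₀.1
  have hmaps : MapsTo (fun t => (q t).2) (Icc t₀ τ') (Icc (p 0).2 (p τ).2) := fun t ht => by
    have h1 := hyq.monotoneOn ht₀ (hsub ht) ht.1
    have h2 := hyq.monotoneOn (hsub ht) (right_mem_Icc.2 hq.time_pos.le) ht.2
    exact ⟨by linarith, by linarith⟩
  have hqc : ContinuousOn q (Icc t₀ τ') := hq.continuousOn.mono hsub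
  have hgq : ContinuousOn (fun t => g (q t).2) (Icc t₀ τ') := hgc.comp hqc.snd hmaps
  have hpg : ContinuousOn (fun t => p (g (q t).2)) (Icc t₀ τ') :=
    hp.continuousOn.comp hgq fun t ht => (hg _ (hmaps ht)).1
  have hinj : ∀ t ∈ Icc t₀ τ', ∀ s ∈ Icc 0 τ, (p s).2 = (q t).2 → g (q t).2 = s :=
    fun t ht s hs h => hyp.injOn (hg _ (hmaps ht)).1 hs ((hg _ (hmaps ht)).2.trans h.symm)
  have hend : 0 ≤ (p (g (q τ').2)).1 - (q τ').1 := by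
    rw [hq.fst_eq_zero, sub_zero]
    exact hp.fst_nonneg (hg _ (hmaps ⟨ht₀lt.le, le_rfl⟩)).1
  have hstart : (p (g (q t₀).2)).1 - (q t₀).1 ≤ 0 := by
    rw [hinj t₀ ⟨le_rfl, ht₀lt.le⟩ 0 ⟨le_rfl, hp.time_pos.le⟩ (hp0.trans hyt₀.symm), hp.init]
    have := hq.fst_pos t₀ ⟨ht₀pos, ht₀lt⟩
    simp only
    linarith
  obtain ⟨t, ht, hteq⟩ := intermediate_value_Icc ht₀lt.le (hpg.fst.sub hqc.fst)
    (show (0 : ℝ) ∈ Icc _ _ from ⟨hstart, hend⟩)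
  have hteq : (p (g (q t).2)).1 = (q t).1 := sub_eq_zero.1 hteq
  obtain ⟨hsm, hsy⟩ := hg _ (hmaps ht)
  have hpq : p (g (q t).2) = q t := Prod.ext hteq hsy
  have hsτ : g (q t).2 < τ := by
    refine hsm.2.lt_of_ne fun h => ?_
    have h1 := hyq.monotoneOn (hsub ht) (right_mem_Icc.2 hq.time_pos.le) ht.2
    rw [h] at hsy
    linarith
  rcases ht.2.eq_or_lt with h | htτ
  · have hx : 0 < (p (g (q t).2)).1 ∨ g (q t).2 = 0 := by
      rcases hsm.1.eq_or_lt with h | h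
      · exact .inr h.symm
      · exact .inl (hp.fst_pos _ ⟨h, hsτ⟩)
    rcases hx with hx | hx
    · rw [hteq, h, hq.fst_eq_zero] at hx
      exact lt_irrefl _ hx
    · rw [hx, hp0, h] at hsy
      linarith
  · exact hcon.ne' (by rw [hp.remaining_eq hq ⟨hsm.1, hsτ⟩ ⟨ht₀pos.le.trans ht.1, htτ⟩ hpq])

lemma le_snd (hμ : 0 < μ) (h : IsHalfTurn μ (1 / μ) p τ) : 1 / μ ≤ (p τ).2 := by
  set V : ℝ → ℝ := fun s => (p s).1 ^ 2 / 2 + μ ^ 2 * (p s).2 ^ 2 / 2 with hV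
  have hV0 : V 0 = 1 / 2 := by simp [hV, h.init, hμ.ne']
  have hVτ : V τ = (μ * (p τ).2) ^ 2 / 2 := by simp [hV, h.fst_eq_zero, mul_pow]
  have hy := h.snd_nonneg hμ
  by_contra! hcon
  have hlt : μ * (p τ).2 < 1 := by
    rw [lt_div_iff₀ hμ] at hcon
    linarith
  have hlt' : V τ < 1 / 2 := by
    rw [hVτ]
    have : 0 ≤ μ * (p τ).2 := by positivity
    nlinarith
  have := le_of_hasDerivAt_pos_of_eq (f := V) (c := (V τ + 1 / 2) / 2)
    (fun t ht => hasDerivAt_energy hμ.ne' (h.sol t ht.1)) (by linarith) (fun t ht heq => by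
      have ht0 : 0 < t := by
        refine ht.1.lt_of_ne fun h0 => ?_
        rw [← h0] at heq
        linarith
      have hx := h.fst_pos t ⟨ht0, ht.2⟩
      have h1 : (p t).1 ^ 2 / 2 + μ ^ 2 * (p t).2 ^ 2 / 2 = (V τ + 1 / 2) / 2 := heq
      have h2 : 0 ≤ μ ^ 2 * (p t).2 ^ 2 / 2 := by positivity
      exact mul_pos hμ (mul_pos (pow_pos hx 2) (by linarith)))
    (right_mem_Icc.2 h.time_pos.le)
  linarith

lemma snd_le (hμ : 0 < μ) (h : IsHalfTurn μ b p τ) (hb : 15 + 9 / μ ^ 2 ≤ b) :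
    (p τ).2 ≤ b := by
  have hμ2 : 0 < 9 / μ ^ 2 := by positivity
  have hy0 : (p 0).2 = -b := by rw [h.init]
  have hyτ := h.snd_nonneg hμ
  have hmono := h.strictMonoOn_snd hμ
  have hτ0 := h.time_pos
  obtain ⟨s, hs, hys⟩ := intermediate_value_Icc hτ0.le h.continuousOn.snd
    (show -b + 1 ∈ Icc (p 0).2 (p τ).2 from ⟨by linarith, by linarith⟩)
  have hys : (p s).2 = -b + 1 := hys
  obtain ⟨t₁, ht₁, hx₁⟩ : ∃ t₁ ∈ Icc 0 s, 3 ≤ (p t₁).1 := by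
    by_contra! hlt
    have h1 := le_of_hasDerivAt_nonneg (f := fun t => 3 / μ * t - (p t).2) hs.1
      (fun t ht => ((hasDerivAt_id t).const_mul (3 / μ)).sub (h.sol.hasDerivAt_snd ht.1))
      (fun t ht => by
        have := hlt t (Ioo_subset_Icc_self ht)
        rw [mul_one, sub_nonneg]
        gcongr)
    have h2 := le_of_hasDerivAt_nonneg (f := fun t => (p t).1 - μ * (b - 7) * t) hs.1
      (fun t ht => (h.sol.hasDerivAt_fst ht.1).sub ((hasDerivAt_id t).const_mul (μ * (b - 7))))
      (fun t ht => by
        have hx1 := hlt t (Ioo_subset_Icc_self ht)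
        have hx0 : 0 ≤ (p t).1 := h.fst_nonneg ⟨ht.1.le, ht.2.le.trans hs.2⟩
        have hy : (p t).2 ≤ (p s).2 :=
          hmono.monotoneOn ⟨ht.1.le, ht.2.le.trans hs.2⟩ hs ht.2.le
        have h3 : b - 7 ≤ (p t).1 - (p t).1 ^ 3 / 3 - (p t).2 := by
          nlinarith [mul_nonneg (by linarith : 0 ≤ 3 - (p t).1)
            (by positivity : 0 ≤ (p t).1 ^ 2 + 3 * (p t).1 + 6)]
        rw [mul_one, sub_nonneg]
        gcongr)
    have hxs := hlt s (right_mem_Icc.2 hs.1)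
    simp only [hys, mul_zero, h.init] at h1 h2
    have h3 : μ / 3 ≤ s := by
      have : 1 ≤ 3 / μ * s := by linarith
      rw [div_mul_eq_mul_div, le_div_iff₀ hμ] at this
      linarith
    have h4 : 9 ≤ (b - 7) * μ ^ 2 := by
      rw [← div_le_iff₀ (by positivity)]
      linarith
    have h5 : μ * (b - 7) * (μ / 3) ≤ μ * (b - 7) * s :=
      mul_le_mul_of_nonneg_left h3 (mul_nonneg hμ.le (by linarith))
    linarith
  have ht₁τ : t₁ ∈ Icc 0 τ := ⟨ht₁.1, ht₁.2.trans hs.2⟩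
  have hy₁ : (p t₁).2 ≤ -b + 1 := hys ▸ hmono.monotoneOn ht₁τ hs ht₁.2
  obtain ⟨t₂, ht₂, hy₂⟩ := intermediate_value_Icc ht₁τ.2
    (h.continuousOn.snd.mono (Icc_subset_Icc_left ht₁.1))
    (show -6 ∈ Icc (p t₁).2 (p τ).2 from ⟨by linarith, by linarith⟩)
  have hy₂ : (p t₂).2 = -6 := hy₂
  have hx : ∀ t ∈ Icc t₁ t₂, 3 ≤ (p t).1 := fun t ht =>
    le_of_hasDerivAt_pos_of_eq (f := fun t => (p t).1)
      (fun u hu => h.sol.hasDerivAt_fst (ht₁.1.trans hu.1)) hx₁ (fun u hu heq => by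
        have hlt := hmono ⟨ht₁.1.trans hu.1, hu.2.le.trans ht₂.2⟩
          ⟨ht₁.1.trans ht₂.1, ht₂.2⟩ hu.2
        have heq : (p u).1 = 3 := heq
        simp only [hy₂] at hlt
        rw [heq]
        exact mul_pos hμ (by linarith)) ht
  set V : ℝ → ℝ := fun s => (p s).1 ^ 2 / 2 + μ ^ 2 * (p s).2 ^ 2 / 2 with hV
  have hslow : ∀ u v, 0 ≤ u → u ≤ v → v ≤ τ →
      V v - V u ≤ 2 / 3 * μ ^ 2 * ((p v).2 - (p u).2) := fun u v hu huv hv => by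
    have := le_of_hasDerivAt_nonneg (f := fun t => 2 / 3 * μ ^ 2 * (p t).2 - V t) huv
      (fun t ht => ((h.sol.hasDerivAt_snd (hu.trans ht.1)).const_mul (2 / 3 * μ ^ 2)).sub
        (hasDerivAt_energy hμ.ne' (h.sol t (hu.trans ht.1)))) (fun t ht => by
          have hx0 : 0 ≤ (p t).1 := h.fst_nonneg ⟨hu.trans ht.1.le, ht.2.le.trans hv⟩
          have : 2 / 3 * μ ^ 2 * ((p t).1 / μ) - μ * ((p t).1 ^ 2 * (1 - (p t).1 ^ 2 / 3))
              = μ * (p t).1 * (((p t).1 - 1) ^ 2 * ((p t).1 + 2)) / 3 := by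
            field_simp
            ring
          rw [this]
          positivity)
    linarith
  have hfast : V t₂ - V t₁ ≤ -6 * μ ^ 2 * ((p t₂).2 - (p t₁).2) := by
    have := le_of_hasDerivAt_nonneg (f := fun t => -6 * μ ^ 2 * (p t).2 - V t) ht₂.1
      (fun t ht => ((h.sol.hasDerivAt_snd (ht₁.1.trans ht.1)).const_mul (-6 * μ ^ 2)).sub
        (hasDerivAt_energy hμ.ne' (h.sol t (ht₁.1.trans ht.1)))) (fun t ht => by
          have hx3 := hx t (Ioo_subset_Icc_self ht)
          have : -6 * μ ^ 2 * ((p t).1 / μ) - μ * ((p t).1 ^ 2 * (1 - (p t).1 ^ 2 / 3))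
              = μ * (p t).1 * (((p t).1 - 3) * ((p t).1 ^ 2 + 3 * (p t).1 + 6)) / 3 := by
            field_simp
            ring
          rw [this]
          have : 0 ≤ (p t).1 - 3 := by linarith
          have : 0 ≤ (p t).1 := by linarith
          positivity)
    linarith
  have e1 := hslow 0 t₁ le_rfl ht₁.1 ht₁τ.2
  have e2 := hslow t₂ τ (ht₁.1.trans ht₂.1) ht₂.2 le_rfl
  have hV0 : V 0 = μ ^ 2 * (b ^ 2 / 2) := by simp [hV, h.init]; ring
  have hVτ : V τ = μ ^ 2 * ((p τ).2 ^ 2 / 2) := by simp [hV, h.fst_eq_zero]; ring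
  rw [hy0, hV0] at e1
  rw [hy₂] at e2 hfast
  rw [hVτ] at e2
  have htotal : μ ^ 2 * ((p τ).2 ^ 2 / 2) ≤ μ ^ 2 * (b ^ 2 / 2 + 2 / 3 * ((p t₁).2 + b)
      + 6 * ((p t₁).2 + 6) + 2 / 3 * ((p τ).2 + 6)) := by linarith
  have htotal := le_of_mul_le_mul_left htotal (by positivity)
  by_contra! hcon
  nlinarith

end IsHalfTurn

/-- Some orbit crosses the line `x = 0` at two consecutive antipodal points. -/
lemma exists_antipodal_isHalfTurn {μ : ℝ} (hμ : 0 < μ) :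
    ∃ b p τ, 0 < b ∧ IsHalfTurn μ b p τ ∧ p τ = (0, b) := by
  have hμ2 : 0 < 9 / μ ^ 2 := by positivity
  set a := 1 / μ with ha
  have ha0 : 0 < a := by positivity
  set c := 15 + 9 / μ ^ 2 + a with hc
  choose! P τ hP using fun b (hb : (0 : ℝ) < b) => exists_isHalfTurn hμ hb
  set φ : ℝ → ℝ := fun b => (P b (τ b)).2 with hφ
  have hmono : ∀ b b', 0 < b → b ≤ b' → φ b ≤ φ b' := fun b b' hb hbb' =>
    (hP b hb).snd_le_snd hμ (hP b' (hb.trans_le hbb')) hb hbb'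
  have hφa : a ≤ φ a := (hP a ha0).le_snd hμ
  have hφc : φ c ≤ c := (hP c (by positivity)).snd_le hμ (by linarith)
  set S := {b ∈ Icc a c | b ≤ φ b} with hS
  have haS : a ∈ S := ⟨⟨le_rfl, by linarith⟩, hφa⟩
  have hbdd : BddAbove S := ⟨c, fun b hb => hb.1.2⟩
  set β := sSup S with hβ
  have haβ : a ≤ β := le_csSup hbdd haS
  have hβc : β ≤ c := csSup_le ⟨a, haS⟩ fun b hb => hb.1.2
  have h1 : β ≤ φ β := csSup_le ⟨a, haS⟩ fun b hb =>
    hb.2.trans (hmono b β (ha0.trans_le hb.1.1) (le_csSup hbdd hb))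
  have h2 : φ β ≤ β := le_csSup hbdd ⟨⟨haβ.trans h1, (hmono β c (by linarith) hβc).trans hφc⟩,
    hmono β (φ β) (by linarith) h1⟩
  have hβ0 : 0 < β := ha0.trans_le haβ
  exact ⟨β, P β, τ β, hβ0, hP β hβ0, Prod.ext (hP β hβ0).fst_eq_zero (le_antisymm h2 h1)⟩

lemma exists_periodic_sol {μ : ℝ} (hμ : 0 < μ) :
    ∃ T : ℝ, 0 < T ∧ ∃ p : ℝ → ℝ × ℝ, Function.Periodic p T ∧ (∃ t₁ t₂, p t₁ ≠ p t₂) ∧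
      ∀ t, HasDerivAt p (vdpField μ (p t)) t := by
  obtain ⟨b, p, τ, hb, hp, hpτ⟩ := exists_antipodal_isHalfTurn hμ
  have hτ := hp.time_pos
  have hanti : ∀ t, 0 ≤ t → p (t + τ) = -p t := fun t ht => by
    have := (hp.sol.shift hτ.le).neg.eq_of_eq hp.sol (by simp [hpτ, hp.init]) ht
    rw [← this, neg_neg]
  set T := 2 * τ with hT
  have hT0 : 0 < T := by positivity
  have hper : ∀ t, 0 ≤ t → p (t + T) = p t := fun t ht => by
    rw [hT, two_mul, ← add_assoc, hanti _ (by positivity), hanti t ht, neg_neg]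
  have hpern : ∀ n : ℕ, ∀ t, 0 ≤ t → p (t + n * T) = p t := by
    intro n
    induction n with
    | zero => simp
    | succ n ih =>
      intro t ht
      rw [Nat.cast_succ, add_mul, one_mul, ← add_assoc, hper _ (by positivity), ih t ht]
  set P : ℝ → ℝ × ℝ := fun t => p (Int.fract (t / T) * T) with hPdef
  have hP : ∀ t, 0 ≤ t → P t = p t := fun t ht => by
    have h1 : (0 : ℝ) ≤ t / T := by positivity
    have h2 := hpern ⌊t / T⌋₊ (Int.fract (t / T) * T)
      (mul_nonneg (Int.fract_nonneg _) hT0.le)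
    rw [← add_mul, natCast_floor_eq_intCast_floor h1, Int.fract_add_floor,
      div_mul_cancel₀ _ hT0.ne'] at h2
    exact h2.symm
  have hPper : Function.Periodic P T := fun t => by
    simp only [hPdef]
    rw [add_div, div_self hT0.ne', Int.fract_add_one]
  refine ⟨T, hT0, P, hPper, ⟨0, τ, ?_⟩, fun t => ?_⟩
  · rw [hP 0 le_rfl, hP τ hτ.le, hp.init, hpτ]
    intro h
    have := congrArg Prod.snd h
    simp only at this
    linarith
  · obtain ⟨n, hn⟩ := exists_nat_gt (-t / T)
    have hn : 0 < t + n * T := by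
      rw [div_lt_iff₀ hT0] at hn
      linarith
    have hPn : ∀ s, P (s + n * T) = P s := fun s => hPper.nat_mul n s
    have hev : P =ᶠ[𝓝 t] fun s => p (s + n * T) := by
      filter_upwards [Ioi_mem_nhds (by linarith : -(n * T) < t)] with s hs
      rw [← hPn s, hP _ (by linarith [mem_Ioi.1 hs])]
    rw [← hPn t, hP _ hn.le]
    exact ((hp.sol _ hn.le).comp_add_const t (n * T)).congr_of_eventuallyEq hev

lemma pos_of_hasDerivAt_ge_mul {f f' a : ℝ → ℝ} (ha : Continuous a)
    (hf : ∀ t, HasDerivAt f (f' t) t) (hge : ∀ t, a t * f t ≤ f' t) {s t : ℝ} (hst : s ≤ t)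
    (hs : 0 < f s) : 0 < f t := by
  have hA : ∀ u, HasDerivAt (fun u => ∫ v in s..u, a v) (a u) u := fun u =>
    ha.integral_hasStrictDerivAt s u |>.hasDerivAt
  have h := le_of_hasDerivAt_nonneg hst (fun u _ => (hf u).mul (hA u).neg.exp) fun u _ => by
    have := mul_nonneg (sub_nonneg.2 (hge u)) (Real.exp_pos (-∫ v in s..u, a v)).le
    simp only [Pi.neg_apply]
    linarith
  simp only [Pi.mul_apply, Pi.neg_apply, intervalIntegral.integral_same, neg_zero, Real.exp_zero,
    mul_one] at h
  exact pos_of_mul_pos_left (hs.trans_le h) (Real.exp_pos _).le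

lemma Function.Periodic.eq_of_antitone {f : ℝ → ℝ} {c : ℝ} (hf : Function.Periodic f c)
    (hc : 0 < c) (hmono : Antitone f) (s t : ℝ) : f s = f t := by
  have key : ∀ s t, f s ≤ f t := fun s t => by
    obtain ⟨n, hn⟩ := exists_nat_ge ((t - s) / c)
    rw [div_le_iff₀ hc] at hn
    rw [← hf.nat_mul n s]
    exact hmono (by linarith)
  exact le_antisymm (key s t) (key t s)

lemma add_nat_mul_period {f : ℝ → ℝ} {c d : ℝ} (hf : ∀ t, f (t + c) = f t + d) (n : ℕ) (t : ℝ) :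
    f (t + n * c) = f t + n * d := by
  induction n with
  | zero => simp
  | succ n ih =>
    rw [Nat.cast_succ, add_one_mul, ← add_assoc, hf, ih]
    ring

lemma surjective_of_add_period {f : ℝ → ℝ} {c d : ℝ} (hd : 0 < d) (hc : Continuous f)
    (hf : ∀ t, f (t + c) = f t + d) : Function.Surjective f := fun y => by
  refine mem_range_of_exists_le_of_exists_ge hc ?_ ?_
  · obtain ⟨n, hn⟩ := exists_nat_ge ((f 0 - y) / d)
    rw [div_le_iff₀ hd] at hn
    have := add_nat_mul_period hf n (0 - n * c)
    rw [sub_add_cancel] at this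
    exact ⟨0 - n * c, by linarith⟩
  · obtain ⟨n, hn⟩ := exists_nat_ge ((y - f 0) / d)
    rw [div_le_iff₀ hd] at hn
    exact ⟨0 + n * c, by linarith [add_nat_mul_period hf n 0]⟩

/-- A nonvanishing `C¹` curve in the plane has a differentiable logarithm. -/
lemma exists_hasDerivAt_exp_eq {z z' : ℝ → ℂ} (hz : ∀ t, HasDerivAt z (z' t) t)
    (hz' : Continuous z') (hne : ∀ t, z t ≠ 0) :
    ∃ L : ℝ → ℂ, (∀ t, HasDerivAt L (z' t / z t) t) ∧ ∀ t, Complex.exp (L t) = z t := by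
  have hzc : Continuous z := continuous_iff_continuousAt.2 fun t => (hz t).continuousAt
  have hL : ∀ t, HasDerivAt (fun t => Complex.log (z 0) + ∫ s in (0 : ℝ)..t, z' s / z s)
      (z' t / z t) t := fun t =>
    ((hz'.div hzc hne).integral_hasStrictDerivAt 0 t).hasDerivAt.const_add _
  refine ⟨_, hL, fun t => ?_⟩
  have hd : ∀ t, HasDerivAt (fun t => z t *
      Complex.exp (-(Complex.log (z 0) + ∫ s in (0 : ℝ)..t, z' s / z s))) 0 t := fun t => by
    refine ((hz t).mul (hL t).fun_neg.cexp).congr_deriv ?_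
    field_simp [hne t]
    ring
  have h := is_const_of_deriv_eq_zero (fun t => (hd t).differentiableAt) (fun t => (hd t).deriv)
    t 0
  simp only [intervalIntegral.integral_same, add_zero, Complex.exp_neg,
    Complex.exp_log (hne 0), mul_inv_cancel₀ (hne 0)] at h
  rw [mul_inv_eq_one₀ (Complex.exp_ne_zero _)] at h
  exact h.symm

/-- The angular momentum `x y' - y x'` of the van der Pol flow. -/
noncomputable def vdpMomentum (μ : ℝ) (p : ℝ × ℝ) : ℝ :=
  p.1 * (vdpField μ p).2 - p.2 * (vdpField μ p).1

/-- The radial speed `x x' + y y'` of the van der Pol flow. -/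
noncomputable def vdpRadial (μ : ℝ) (p : ℝ × ℝ) : ℝ :=
  p.1 * (vdpField μ p).1 + p.2 * (vdpField μ p).2

lemma vdpRadial_mul_vdpMomentum_sub {μ : ℝ} (hμ : μ ≠ 0) (k : ℝ) (p : ℝ × ℝ) :
    vdpRadial μ (k • p) * vdpMomentum μ p - vdpRadial μ p * vdpMomentum μ (k • p) =
      k ^ 2 * (1 - k ^ 2) * p.1 ^ 4 * (p.1 ^ 2 + p.2 ^ 2) / 3 := by
  simp only [vdpRadial, vdpMomentum, vdpField, Prod.smul_fst, Prod.smul_snd, smul_eq_mul]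
  field_simp
  ring

/-- A nonconstant periodic solution of the van der Pol system. -/
structure IsCycle (μ T : ℝ) (p : ℝ → ℝ × ℝ) : Prop where
  pos : 0 < T
  hasDerivAt : ∀ t, HasDerivAt p (vdpField μ (p t)) t
  periodic : Function.Periodic p T
  nonconst : ∃ t₁ t₂, p t₁ ≠ p t₂

namespace IsCycle

variable {μ T : ℝ} {p : ℝ → ℝ × ℝ}

lemma continuous (hp : IsCycle μ T p) : Continuous p :=
  continuous_iff_continuousAt.2 fun t => (hp.hasDerivAt t).continuousAt

lemma hasDerivAt_fst (hp : IsCycle μ T p) (t : ℝ) :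
    HasDerivAt (fun s => (p s).1) (μ * ((p t).1 - (p t).1 ^ 3 / 3 - (p t).2)) t :=
  (hp.hasDerivAt t).fst

lemma hasDerivAt_snd (hp : IsCycle μ T p) (t : ℝ) :
    HasDerivAt (fun s => (p s).2) ((p t).1 / μ) t :=
  (hp.hasDerivAt t).snd

lemma exists_ge (hp : IsCycle μ T p) (s t : ℝ) : ∃ u, s ≤ u ∧ p u = p t := by
  obtain ⟨n, hn⟩ := exists_nat_ge ((s - t) / T)
  rw [div_le_iff₀ hp.pos] at hn
  exact ⟨t + n * T, by linarith, hp.periodic.nat_mul n t⟩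

lemma ne_zero (hp : IsCycle μ T p) (t : ℝ) : p t ≠ 0 := by
  intro h
  have hzero : ∀ s, t ≤ s → p s = 0 := fun s hs =>
    eqOn_Icc_of_vdpField (q := fun _ => 0) (fun u _ => hp.hasDerivAt u)
      (fun u _ => (hasDerivAt_const u (0 : ℝ × ℝ)).congr_deriv (by simp [vdpField, Prod.ext_iff]))
      h (right_mem_Icc.2 hs)
  have hall : ∀ s, p s = 0 := fun s => by
    obtain ⟨u, hu, hus⟩ := hp.exists_ge t s
    rw [← hus, hzero u hu]
  obtain ⟨t₁, t₂, hne⟩ := hp.nonconst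
  exact hne ((hall t₁).trans (hall t₂).symm)

lemma normSq_pos (hp : IsCycle μ T p) (t : ℝ) : 0 < (p t).1 ^ 2 + (p t).2 ^ 2 := by
  by_contra! h
  exact hp.ne_zero t (Prod.ext (by simp; nlinarith) (by simp; nlinarith))

lemma exists_fst_eq_zero (hμ : 0 < μ) (hp : IsCycle μ T p) : ∃ t, (p t).1 = 0 := by
  obtain ⟨t, -, ht⟩ := isCompact_Icc.exists_isMaxOn (nonempty_Icc.2 hp.pos.le)
    hp.continuous.snd.continuousOn
  refine ⟨t, ?_⟩
  have hmax : IsLocalMax (fun s => (p s).2) t := Filter.Eventually.of_forall fun s => by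
    obtain ⟨u, hu, hus⟩ := hp.periodic.exists_mem_Ico₀ hp.pos s
    simp only [hus]
    exact ht (Ico_subset_Icc_self hu)
  exact (div_eq_zero_iff.1 (hmax.hasDerivAt_eq_zero (hp.hasDerivAt_snd t))).resolve_right hμ.ne'

lemma vdpMomentum_pos (hμ : 0 < μ) (hp : IsCycle μ T p) (t : ℝ) : 0 < vdpMomentum μ (p t) := by
  obtain ⟨s, hs⟩ := hp.exists_fst_eq_zero hμ
  obtain ⟨u, hu, hut⟩ := hp.exists_ge s t
  rw [← hut]
  have hy : (p s).2 ≠ 0 := fun h => hp.ne_zero s (Prod.ext hs h)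
  refine pos_of_hasDerivAt_ge_mul (f := fun t => vdpMomentum μ (p t))
    (f' := fun t => μ * (1 - (p t).1 ^ 2) * vdpMomentum μ (p t) + 2 / 3 * (p t).1 ^ 4)
    (a := fun t => μ * (1 - (p t).1 ^ 2)) ?_ (fun v => ?_) (fun v => ?_) hu ?_
  · have := hp.continuous
    fun_prop
  · have hx := hp.hasDerivAt_fst v
    have hy := hp.hasDerivAt_snd v
    simp only [vdpMomentum, vdpField]
    refine ((hx.mul (hx.div_const μ)).sub (hy.mul
      (((hx.sub ((hx.pow 3).div_const 3)).sub hy).const_mul μ))).congr_deriv ?_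
    simp only [Pi.sub_apply, Pi.pow_apply]
    field_simp
    ring
  · have : 0 ≤ 2 / 3 * (p v).1 ^ 4 := by positivity
    simpa using this
  · have : 0 < μ * (p s).2 ^ 2 := by positivity
    simp only [vdpMomentum, vdpField, hs]
    linarith

lemma exists_fst_ne_zero (hμ : 0 < μ) (hp : IsCycle μ T p) : ∃ t, (p t).1 ≠ 0 := by
  by_contra! h
  have hd : HasDerivAt (fun s => (p s).1) 0 0 := by
    simp only [h]
    exact hasDerivAt_const _ _
  have := hd.unique (hp.hasDerivAt_fst 0)
  have hy : (p 0).2 = 0 := by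
    simpa [h 0, hμ.ne'] using this
  exact hp.ne_zero 0 (Prod.ext (h 0) hy)

lemma exists_polar (hμ : 0 < μ) (hp : IsCycle μ T p) :
    ∃ ρ θ : ℝ → ℝ,
      (∀ t, HasDerivAt ρ (vdpRadial μ (p t) / ((p t).1 ^ 2 + (p t).2 ^ 2)) t) ∧
      (∀ t, HasDerivAt θ (vdpMomentum μ (p t) / ((p t).1 ^ 2 + (p t).2 ^ 2)) t) ∧
      (∀ t, p t = Real.exp (ρ t) • (Real.cos (θ t), Real.sin (θ t))) ∧
      ∃ n : ℕ, 0 < n ∧ (∀ t, ρ (t + T) = ρ t) ∧ ∀ t, θ (t + T) = θ t + n * (2 * Real.pi) := by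
  set e := Complex.equivRealProdCLM.symm with he
  set z : ℝ → ℂ := fun t => e (p t) with hz
  have hfield : Continuous fun t => e (vdpField μ (p t)) :=
    e.continuous.comp ((contDiff_vdpField μ).continuous.comp hp.continuous)
  have hne : ∀ t, z t ≠ 0 := fun t => e.map_ne_zero_iff.2 (hp.ne_zero t)
  obtain ⟨L, hL, hexp⟩ := exists_hasDerivAt_exp_eq (z := z)
    (fun t => e.hasFDerivAt.comp_hasDerivAt t (hp.hasDerivAt t)) hfield hne
  have hzT : Function.Periodic z T := fun t => congrArg e (hp.periodic t)
  have hnorm : ∀ t, Complex.normSq (z t) = (p t).1 ^ 2 + (p t).2 ^ 2 := fun t => by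
    simp [hz, he, Complex.normSq_apply, sq]
  have hρ : ∀ t, HasDerivAt (fun t => (L t).re)
      (vdpRadial μ (p t) / ((p t).1 ^ 2 + (p t).2 ^ 2)) t := fun t => by
    refine (Complex.reCLM.hasFDerivAt.comp_hasDerivAt t (hL t)).congr_deriv ?_
    simp only [Complex.reCLM_apply, Complex.div_re, hnorm]
    simp [hz, he, vdpRadial]
    ring
  have hθ : ∀ t, HasDerivAt (fun t => (L t).im)
      (vdpMomentum μ (p t) / ((p t).1 ^ 2 + (p t).2 ^ 2)) t := fun t => by
    refine (Complex.imCLM.hasFDerivAt.comp_hasDerivAt t (hL t)).congr_deriv ?_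
    simp only [Complex.imCLM_apply, Complex.div_im, hnorm]
    simp [hz, he, vdpMomentum]
    ring
  refine ⟨_, _, hρ, hθ, fun t => ?_, ?_⟩
  · have h1 := congrArg Complex.re (hexp t)
    have h2 := congrArg Complex.im (hexp t)
    rw [Complex.exp_re] at h1
    rw [Complex.exp_im] at h2
    exact Prod.ext h1.symm h2.symm
  have hconst : ∀ t, L (t + T) - L t = L (0 + T) - L 0 := fun t =>
    is_const_of_deriv_eq_zero (f := fun t => L (t + T) - L t) (fun t =>
      (((hL (t + T)).comp_add_const t T).sub (hL t)).differentiableAt) (fun t => by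
        rw [(((hL (t + T)).comp_add_const t T).fun_sub (hL t)).deriv, hp.periodic t, hzT t,
          sub_self]) t 0
  obtain ⟨n, hn⟩ := Complex.exp_eq_exp_iff_exists_int.1
    ((hexp (0 + T)).trans ((hzT 0).trans (hexp 0).symm))
  have hshift : ∀ t, L (t + T) = L t + n * (2 * Real.pi * Complex.I) := fun t => by
    have := hconst t
    rw [hn] at this
    linear_combination this
  have hθT : ∀ t, (L (t + T)).im = (L t).im + n * (2 * Real.pi) := fun t => by
    simp [hshift t]
  have hlt : (L 0).im < (L (0 + T)).im := by
    refine lt_of_hasDerivAt_pos (f := fun t => (L t).im) (by linarith [hp.pos])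
      (fun t _ => hθ t) fun t _ => ?_
    rw [← hnorm]
    exact div_pos (hp.vdpMomentum_pos hμ t) (Complex.normSq_pos.2 (hne t))
  have hn0 : 0 < n := by
    rw [hθT 0, lt_add_iff_pos_right] at hlt
    exact_mod_cast pos_of_mul_pos_left hlt Real.two_pi_pos.le
  lift n to ℕ using hn0.le
  exact ⟨n, by exact_mod_cast hn0, fun t => by simp [hshift t], fun t => by simpa using hθT t⟩

lemma range_eq {T₁ T₂ : ℝ} {p q : ℝ → ℝ × ℝ} (hμ : 0 < μ) (hp : IsCycle μ T₁ p)
    (hq : IsCycle μ T₂ q) : range p = range q := by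
  obtain ⟨ρ₁, θ₁, hρ₁, hθ₁, hpol₁, m, hm, hρT₁, hθT₁⟩ := hp.exists_polar hμ
  obtain ⟨ρ₂, θ₂, hρ₂, hθ₂, hpol₂, n, hn, hρT₂, hθT₂⟩ := hq.exists_polar hμ
  have hW₁ := hp.vdpMomentum_pos hμ
  have hR₁ := hp.normSq_pos
  have hθ₁mono : StrictMono θ₁ := fun s t hst =>
    lt_of_hasDerivAt_pos hst (fun u _ => hθ₁ u) fun u _ => div_pos (hW₁ u) (hR₁ u)
  have hθ₁surj := surjective_of_add_period (by positivity)
    (continuous_iff_continuousAt.2 fun t => (hθ₁ t).continuousAt) hθT₁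
  have hθ₂surj := surjective_of_add_period (by positivity)
    (continuous_iff_continuousAt.2 fun t => (hθ₂ t).continuousAt) hθT₂
  let e := hθ₁mono.orderIsoOfSurjective θ₁ hθ₁surj
  have he : ∀ u, θ₁ (e.symm u) = u := e.apply_symm_apply
  have hed : ∀ u, HasDerivAt e.symm (vdpMomentum μ (p (e.symm u)) /
      ((p (e.symm u)).1 ^ 2 + (p (e.symm u)).2 ^ 2))⁻¹ u := fun u =>
    HasDerivAt.of_local_left_inverse e.symm.continuous.continuousAt (hθ₁ (e.symm u))
      (div_pos (hW₁ _) (hR₁ _)).ne' (Filter.Eventually.of_forall he)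
  set τ : ℝ → ℝ := fun t => e.symm (θ₂ t) with hτ
  have hτsurj : Function.Surjective τ := e.symm.surjective.comp hθ₂surj
  set δ : ℝ → ℝ := fun t => ρ₂ t - ρ₁ (τ t) with hδ
  have hsmul : ∀ t, q t = Real.exp (δ t) • p (τ t) := fun t => by
    rw [hpol₂ t, hpol₁ (τ t), smul_smul, ← Real.exp_add, hτ, he, hδ, sub_add_cancel]
  have hδd : ∀ t, HasDerivAt δ
      ((1 - Real.exp (δ t) ^ 2) * ((p (τ t)).1 ^ 4 / (3 * vdpMomentum μ (p (τ t))))) t := by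
    intro t
    refine ((hρ₂ t).sub ((hρ₁ (τ t)).comp t ((hed (θ₂ t)).comp t (hθ₂ t)))).congr_deriv ?_
    have key := vdpRadial_mul_vdpMomentum_sub hμ.ne' (Real.exp (δ t)) (p (τ t))
    rw [← hsmul] at key
    have hR : (q t).1 ^ 2 + (q t).2 ^ 2 =
        Real.exp (δ t) ^ 2 * ((p (τ t)).1 ^ 2 + (p (τ t)).2 ^ 2) := by
      simp only [hsmul t, Prod.smul_fst, Prod.smul_snd, smul_eq_mul]
      ring
    have h1 := (hW₁ (τ t)).ne'
    have h2 := (hR₁ (τ t)).ne'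
    have h3 := (Real.exp_pos (δ t)).ne'
    change _ - vdpRadial μ (p (τ t)) / ((p (τ t)).1 ^ 2 + (p (τ t)).2 ^ 2) *
      ((vdpMomentum μ (p (τ t)) / ((p (τ t)).1 ^ 2 + (p (τ t)).2 ^ 2))⁻¹ * _) = _
    rw [hR]
    generalize (p (τ t)).1 ^ 2 + (p (τ t)).2 ^ 2 = R at *
    generalize vdpMomentum μ (p (τ t)) = W at *
    generalize Real.exp (δ t) = k at *
    field_simp
    field_simp at key
    linear_combination key
  have hsign : ∀ d : ℝ, d * (1 - Real.exp d ^ 2) ≤ 0 := fun d => by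
    rcases le_total 0 d with h | h
    · have := one_le_pow₀ (Real.one_le_exp h) (n := 2)
      exact mul_nonpos_of_nonneg_of_nonpos h (by linarith)
    · have := pow_le_one₀ (Real.exp_pos d).le (Real.exp_le_one_iff.2 h) (n := 2)
      exact mul_nonpos_of_nonpos_of_nonneg h (by linarith)
  have hδ2 : ∀ t, HasDerivAt (fun t => δ t ^ 2) (2 * (δ t * (1 - Real.exp (δ t) ^ 2)) *
      ((p (τ t)).1 ^ 4 / (3 * vdpMomentum μ (p (τ t))))) t := fun t =>
    ((hδd t).pow 2).congr_deriv (by simp; ring)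
  have hanti : Antitone fun t => δ t ^ 2 := by
    refine antitone_of_deriv_nonpos (fun t => (hδ2 t).differentiableAt) fun t => ?_
    rw [(hδ2 t).deriv]
    have := hW₁ (τ t)
    exact mul_nonpos_of_nonpos_of_nonneg (by linarith [hsign (δ t)]) (by positivity)
  have hper : Function.Periodic (fun t => δ t ^ 2) (m * T₂) := fun t => by
    have h1 : ρ₂ (t + m * T₂) = ρ₂ t := (show Function.Periodic ρ₂ T₂ from hρT₂).nat_mul m t
    have h2 : τ (t + m * T₂) = τ t + n * T₁ := hθ₁mono.injective <| by
      rw [hτ, he, add_nat_mul_period hθT₁, add_nat_mul_period hθT₂, he]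
      ring
    have h3 : ρ₁ (τ t + n * T₁) = ρ₁ (τ t) :=
      (show Function.Periodic ρ₁ T₁ from hρT₁).nat_mul n (τ t)
    simp only [hδ, h1, h2, h3]
  have hconst := hper.eq_of_antitone (mul_pos (Nat.cast_pos.2 hm) hq.pos) hanti
  obtain ⟨s, hs⟩ := hp.exists_fst_ne_zero hμ
  obtain ⟨t, rfl⟩ := hτsurj s
  have hδt : δ t = 0 := by
    have hd := (hδ2 t).unique (by simpa only [hconst _ 0] using hasDerivAt_const t (δ 0 ^ 2))
    have := hW₁ (τ t)
    have h0 : δ t * (1 - Real.exp (δ t) ^ 2) = 0 := by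
      simpa [hs, this.ne'] using hd
    by_contra hne
    have := (mul_eq_zero.1 h0).resolve_left hne
    rw [sub_eq_zero, eq_comm, pow_eq_one_iff_of_nonneg (Real.exp_pos _).le two_ne_zero,
      Real.exp_eq_one_iff] at this
    exact hne this
  have hqp : q = p ∘ τ := funext fun s => by
    have : δ s = 0 := by
      have := hconst s t
      simpa [hδt] using this
    rw [hsmul, this, Real.exp_zero, one_smul, Function.comp_apply]
  rw [hqp, hτsurj.range_comp]

end IsCycle

/-- Liénard's theorem for the van der Pol system: for `μ > 0`, the planar
system `x' = μ(x - x³/3 - y)`, `y' = x/μ` possesses a nonconstant periodic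
solution, and this periodic orbit is unique: any two nonconstant periodic
solutions have the same image in `ℝ²`. -/
theorem van_der_pol_unique_limit_cycle (μ : ℝ) (hμ : 0 < μ) :
    (∃ T : ℝ, 0 < T ∧ ∃ xy : ℝ → ℝ × ℝ, Differentiable ℝ xy ∧
      Function.Periodic xy T ∧ (∃ t₁ t₂, xy t₁ ≠ xy t₂) ∧
      ∀ t, deriv xy t =
        (μ * ((xy t).1 - (xy t).1 ^ 3 / 3 - (xy t).2), (xy t).1 / μ)) ∧
    (∀ (T₁ T₂ : ℝ) (xy₁ xy₂ : ℝ → ℝ × ℝ), 0 < T₁ → 0 < T₂ →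
      Differentiable ℝ xy₁ → Differentiable ℝ xy₂ →
      Function.Periodic xy₁ T₁ → Function.Periodic xy₂ T₂ →
      (∃ t₁ t₂, xy₁ t₁ ≠ xy₁ t₂) → (∃ t₁ t₂, xy₂ t₁ ≠ xy₂ t₂) →
      (∀ t, deriv xy₁ t =
        (μ * ((xy₁ t).1 - (xy₁ t).1 ^ 3 / 3 - (xy₁ t).2), (xy₁ t).1 / μ)) →
      (∀ t, deriv xy₂ t =
        (μ * ((xy₂ t).1 - (xy₂ t).1 ^ 3 / 3 - (xy₂ t).2), (xy₂ t).1 / μ)) →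
      Set.range xy₁ = Set.range xy₂) := by
  have key : ∀ (T : ℝ) (p : ℝ → ℝ × ℝ), 0 < T → Differentiable ℝ p → Function.Periodic p T →
      (∃ t₁ t₂, p t₁ ≠ p t₂) → (∀ t, deriv p t = vdpField μ (p t)) → IsCycle μ T p :=
    fun T p hT hd hper hne hp => ⟨hT, fun t => hp t ▸ (hd t).hasDerivAt, hper, hne⟩
  refine ⟨?_, fun T₁ T₂ p q hT₁ hT₂ hp hq hpT hqT hpne hqne hp' hq' =>
    (key T₁ p hT₁ hp hpT hpne hp').range_eq hμ (key T₂ q hT₂ hq hqT hqne hq')⟩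
  obtain ⟨T, hT, p, hper, hne, hp⟩ := exists_periodic_sol hμ
  exact ⟨T, hT, p, fun t => (hp t).differentiableAt, hper, hne, fun t => (hp t).deriv⟩
end

section
/- Let α > 0, τ > 0, and β ∈ ℝ with |β| < 1. Then the unforced ice-age model τ·x' = -(y + β), τ·y' = -α·(y³/3 - y - x) admits a nonconstant periodic solution: there exist T > 0 and a nonconstant differentiable T-periodic function (x, y) : ℝ → ℝ² satisfying τ·x'(t) = -(y(t) + β) and τ·y'(t) = -α·(y(t)³/3 - y(t) - x(t)) for all t. -/
open Set Filter Topology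
open scoped NNReal

theorem exists_global_solution {E : Type*} [NormedAddCommGroup E] [NormedSpace ℝ E]
    [CompleteSpace E] {f : E → E} {K C : ℝ≥0} (hf : LipschitzWith K f)
    (hC : ∀ x, ‖f x‖ ≤ C) (x₀ : E) :
    ∃ γ : ℝ → E, γ 0 = x₀ ∧ ∀ t, HasDerivAt γ (f (γ t)) t := by
  have step : ∀ n : ℕ, ∃ γ : ℝ → E, γ 0 = x₀ ∧
      ∀ t ∈ Ioo (-(n + 1 : ℝ)) (n + 1), HasDerivAt γ (f (γ t)) t := by
    intro n
    have hn : (0 : ℝ) ≤ n + 1 := by positivity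
    have hPL : IsPicardLindelof (fun _ : ℝ ↦ f) (tmin := -(n + 1 : ℝ)) (tmax := n + 1)
        ⟨0, by constructor <;> linarith⟩ x₀ (C * (n + 1)) 0 C K :=
      { lipschitzOnWith := fun t _ ↦ hf.lipschitzOnWith
        continuousOn := fun x _ ↦ continuousOn_const
        norm_le := fun t _ x _ ↦ hC x
        mul_max_le := by simp }
    obtain ⟨γ, h0, h⟩ := hPL.exists_eq_forall_mem_Icc_hasDerivWithinAt₀
    exact ⟨γ, h0, fun t ht ↦ (h t (Ioo_subset_Icc_self ht)).hasDerivAt (Icc_mem_nhds ht.1 ht.2)⟩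
  choose γ h0 hγ using step
  have agree : ∀ m n : ℕ, m ≤ n → EqOn (γ m) (γ n) (Ioo (-(m + 1 : ℝ)) (m + 1)) := by
    intro m n hmn
    have hmn' : (m : ℝ) ≤ n := by exact_mod_cast hmn
    have hm : (0 : ℝ) ≤ m := by positivity
    refine ODE_solution_unique_of_mem_Ioo (v := fun _ ↦ f) (s := fun _ ↦ univ) (K := K) (t₀ := 0)
      (fun t _ ↦ hf.lipschitzOnWith) ⟨by linarith, by linarith⟩ (fun t ht ↦ ⟨hγ m t ht, mem_univ _⟩)
      (fun t ht ↦ ⟨hγ n t ⟨by linarith [ht.1], by linarith [ht.2]⟩, mem_univ _⟩) ?_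
    rw [h0, h0]
  have key : ∀ (n : ℕ), ∀ t ∈ Ioo (-(n + 1 : ℝ)) (n + 1), γ ⌈|t|⌉₊ t = γ n t := by
    intro n t ht
    have hlt : |t| < ⌈|t|⌉₊ + 1 := lt_of_le_of_lt (Nat.le_ceil _) (lt_add_one _)
    rcases le_total ⌈|t|⌉₊ n with h | h
    · exact agree _ _ h (abs_lt.mp hlt)
    · exact (agree _ _ h ht).symm
  refine ⟨fun t ↦ γ ⌈|t|⌉₊ t, h0 _, fun t ↦ ?_⟩
  have ht : t ∈ Ioo (-(⌈|t|⌉₊ + 1 : ℝ)) (⌈|t|⌉₊ + 1) :=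
    abs_lt.mp (lt_of_le_of_lt (Nat.le_ceil _) (lt_add_one _))
  refine (hγ _ t ht).congr_of_eventuallyEq ?_
  filter_upwards [Ioo_mem_nhds ht.1 ht.2] with s hs using key _ s hs

theorem solution_eq_of_eq {E : Type*} [NormedAddCommGroup E] [NormedSpace ℝ E]
    {f : E → E} {K : ℝ≥0} (hf : LipschitzWith K f) {γ₁ γ₂ : ℝ → E}
    (h₁ : ∀ t, HasDerivAt γ₁ (f (γ₁ t)) t) (h₂ : ∀ t, HasDerivAt γ₂ (f (γ₂ t)) t)
    {t₁ t₂ : ℝ} (h : γ₁ t₁ = γ₂ t₂) (t : ℝ) : γ₁ (t + t₁) = γ₂ (t + t₂) := by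
  refine congrFun (ODE_solution_unique_univ (v := fun _ ↦ f) (s := fun _ ↦ univ) (K := K)
    (t₀ := 0) (f := fun t ↦ γ₁ (t + t₁)) (g := fun t ↦ γ₂ (t + t₂))
    (fun t ↦ hf.lipschitzOnWith) (fun t ↦ ⟨(h₁ _).comp_add_const t t₁, mem_univ _⟩)
    (fun t ↦ ⟨(h₂ _).comp_add_const t t₂, mem_univ _⟩) (by simpa using h)) t

theorem le_of_deriv_neg_at_level {f f' : ℝ → ℝ} {c T : ℝ}
    (hf : ∀ t ∈ Icc 0 T, HasDerivAt f (f' t) t) (h0 : f 0 ≤ c)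
    (h : ∀ t ∈ Icc 0 T, f t = c → f' t < 0) : ∀ t ∈ Icc 0 T, f t ≤ c :=
  image_le_of_deriv_right_lt_deriv_boundary' (B := fun _ ↦ c) (B' := fun _ ↦ 0)
    (fun t ht ↦ (hf t ht).continuousAt.continuousWithinAt)
    (fun t ht ↦ (hf t (Ico_subset_Icc_self ht)).hasDerivWithinAt) h0 continuousOn_const
    (fun _ _ ↦ hasDerivWithinAt_const _ _ _) fun t ht ↦ h t (Ico_subset_Icc_self ht)

theorem ge_of_deriv_nonneg_below {f f' : ℝ → ℝ} {c T : ℝ}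
    (hf : ∀ t ∈ Icc 0 T, HasDerivAt f (f' t) t) (h0 : c ≤ f 0)
    (h : ∀ t ∈ Icc 0 T, f t < c → 0 ≤ f' t) : ∀ t ∈ Icc 0 T, c ≤ f t := by
  intro t ht
  have key : ∀ δ > 0, c - δ * (1 + t) ≤ f t := by
    intro δ hδ
    have := image_le_of_deriv_right_lt_deriv_boundary' (f := fun t ↦ -f t) (f' := fun t ↦ -f' t)
      (a := 0) (b := T) (B := fun t ↦ -c + δ * (1 + t)) (B' := fun _ ↦ δ)
      (fun t ht ↦ (hf t ht).neg.continuousAt.continuousWithinAt)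
      (fun t ht ↦ (hf t (Ico_subset_Icc_self ht)).neg.hasDerivWithinAt) (by linarith)
      (by fun_prop)
      (fun t _ ↦ by
        simpa using ((((hasDerivAt_id t).const_add 1).const_mul δ).const_add (-c)).hasDerivWithinAt)
      (fun t ht hb ↦ by
        have h1 : 0 < δ * (1 + t) := mul_pos hδ (by linarith [ht.1])
        have := h t (Ico_subset_Icc_self ht) (by linarith)
        linarith) ht
    linarith
  by_contra! hlt
  have h1 : 0 < 1 + t := by linarith [ht.1]
  have := key ((c - f t) / (2 * (1 + t))) (by apply div_pos <;> linarith)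
  have h2 : (c - f t) / (2 * (1 + t)) * (1 + t) = (c - f t) / 2 := by field_simp
  linarith

theorem MonotoneOn.exists_fixedPoint_Icc {f : ℝ → ℝ} {a b : ℝ} (hab : a ≤ b)
    (hf : MonotoneOn f (Icc a b)) (hmaps : MapsTo f (Icc a b) (Icc a b)) :
    ∃ x ∈ Icc a b, f x = x := by
  set S := {x ∈ Icc a b | x ≤ f x}
  have haS : a ∈ S := ⟨left_mem_Icc.2 hab, (hmaps (left_mem_Icc.2 hab)).1⟩
  have hbdd : BddAbove S := ⟨b, fun x hx ↦ hx.1.2⟩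
  have hs : sSup S ∈ Icc a b := ⟨le_csSup hbdd haS, csSup_le ⟨a, haS⟩ fun x hx ↦ hx.1.2⟩
  have h1 : sSup S ≤ f (sSup S) :=
    csSup_le ⟨a, haS⟩ fun x hx ↦ hx.2.trans (hf hx.1 hs (le_csSup hbdd hx))
  exact ⟨_, hs, le_antisymm (le_csSup hbdd ⟨hmaps hs, hf hs (hmaps hs) h1⟩) h1⟩

theorem exists_continuousOn_comp_eq {w v : ℝ → ℝ} {a b : ℝ} (hw : ContinuousOn w (Icc a b))
    (hv : ContinuousOn v (Icc a b)) (hinj : InjOn w (Icc a b)) :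
    ∃ g : ℝ → ℝ, ContinuousOn g (w '' Icc a b) ∧ ∀ t ∈ Icc a b, g (w t) = v t := by
  refine ⟨v ∘ Function.invFunOn w (Icc a b), ?_, fun t ht ↦ ?_⟩
  · have hg : ∀ t ∈ Icc a b, (v ∘ Function.invFunOn w (Icc a b)) (w t) = v t := fun t ht ↦ by
      simp [hinj.leftInvOn_invFunOn ht]
    rw [continuousOn_iff_isClosed]
    intro C hC
    refine ⟨w '' (Icc a b ∩ v ⁻¹' C), ?_, ?_⟩
    · have hcl : IsClosed (Icc a b ∩ v ⁻¹' C) := hv.preimage_isClosed_of_isClosed isClosed_Icc hC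
      exact ((isCompact_Icc.of_isClosed_subset hcl inter_subset_left).image_of_continuousOn
        (hw.mono inter_subset_left)).isClosed
    · ext x
      constructor
      · rintro ⟨hx, t, ht, rfl⟩
        rw [mem_preimage, hg t ht] at hx
        exact ⟨⟨t, ⟨ht, hx⟩, rfl⟩, ⟨t, ht, rfl⟩⟩
      · rintro ⟨⟨t, ⟨ht, hx⟩, rfl⟩, h⟩
        refine ⟨?_, h⟩
        rw [mem_preimage, hg t ht]
        exact hx
  · simp [hinj.leftInvOn_invFunOn ht]

theorem half_orbit_endpoint_antitone {f : ℝ × ℝ → ℝ × ℝ} {K : ℝ≥0} (hf : LipschitzWith K f)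
    {γ₁ γ₂ : ℝ → ℝ × ℝ}
    (h₁ : ∀ t, HasDerivAt γ₁ (f (γ₁ t)) t) (h₂ : ∀ t, HasDerivAt γ₂ (f (γ₂ t)) t)
    {T₁ T₂ : ℝ} (hT₁ : 0 < T₁) (hT₂ : 0 < T₂)
    (hs₁ : (γ₁ 0).2 = 0) (hs₂ : (γ₂ 0).2 = 0) (he₁ : (γ₁ T₁).2 = 0) (he₂ : (γ₂ T₂).2 = 0)
    (hp₁ : ∀ t ∈ Ioo 0 T₁, 0 < (γ₁ t).2) (hp₂ : ∀ t ∈ Ioo 0 T₂, 0 < (γ₂ t).2)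
    (ha₁ : StrictAntiOn (fun t ↦ (γ₁ t).1) (Icc 0 T₁))
    (ha₂ : StrictAntiOn (fun t ↦ (γ₂ t).1) (Icc 0 T₂))
    (hlt : (γ₁ 0).1 < (γ₂ 0).1) (hsep : (γ₂ T₂).1 < (γ₁ 0).1) :
    (γ₂ T₂).1 ≤ (γ₁ T₁).1 := by
  by_contra! hcon
  have hc₁ : Continuous γ₁ := continuous_iff_continuousAt.2 fun t ↦ (h₁ t).continuousAt
  have hc₂ : Continuous γ₂ := continuous_iff_continuousAt.2 fun t ↦ (h₂ t).continuousAt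
  obtain ⟨g₁, hg₁, hgv₁⟩ := exists_continuousOn_comp_eq (w := fun t ↦ (γ₁ t).1)
    (v := fun t ↦ (γ₁ t).2) (a := 0) (b := T₁) (by fun_prop) (by fun_prop) ha₁.injOn
  obtain ⟨g₂, hg₂, hgv₂⟩ := exists_continuousOn_comp_eq (w := fun t ↦ (γ₂ t).1)
    (v := fun t ↦ (γ₂ t).2) (a := 0) (b := T₂) (by fun_prop) (by fun_prop) ha₂.injOn
  have him₁ : Icc (γ₁ T₁).1 (γ₁ 0).1 ⊆ (fun t ↦ (γ₁ t).1) '' Icc 0 T₁ :=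
    intermediate_value_Icc' hT₁.le (f := fun t ↦ (γ₁ t).1) (by fun_prop)
  have him₂ : Icc (γ₂ T₂).1 (γ₂ 0).1 ⊆ (fun t ↦ (γ₂ t).1) '' Icc 0 T₂ :=
    intermediate_value_Icc' hT₂.le (f := fun t ↦ (γ₂ t).1) (by fun_prop)
  have hdiff : ContinuousOn (fun x ↦ g₂ x - g₁ x) (Icc (γ₂ T₂).1 (γ₁ 0).1) :=
    (hg₂.mono ((Icc_subset_Icc_right hlt.le).trans him₂)).sub
      (hg₁.mono ((Icc_subset_Icc_left hcon.le).trans him₁))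
  have hnonneg₁ : ∀ t ∈ Icc 0 T₁, 0 ≤ (γ₁ t).2 := by
    intro t ht
    rcases ht.1.eq_or_lt with rfl | h0
    · exact hs₁.ge
    rcases ht.2.eq_or_lt with rfl | hT
    · exact he₁.ge
    · exact (hp₁ t ⟨h0, hT⟩).le
  have hnonneg₂ : ∀ t ∈ Icc 0 T₂, 0 ≤ (γ₂ t).2 := by
    intro t ht
    rcases ht.1.eq_or_lt with rfl | h0
    · exact hs₂.ge
    rcases ht.2.eq_or_lt with rfl | hT
    · exact he₂.ge
    · exact (hp₂ t ⟨h0, hT⟩).le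
  have hleft : g₂ (γ₂ T₂).1 - g₁ (γ₂ T₂).1 ≤ 0 := by
    obtain ⟨t, ht, hteq⟩ := him₁ ⟨hcon.le, hsep.le⟩
    have e1 := hgv₁ t ht
    have e2 := hgv₂ T₂ (right_mem_Icc.2 hT₂.le)
    simp only at hteq e1 e2
    rw [hteq] at e1
    rw [e1, e2, he₂]
    linarith [hnonneg₁ t ht]
  have hright : 0 ≤ g₂ (γ₁ 0).1 - g₁ (γ₁ 0).1 := by
    obtain ⟨t, ht, hteq⟩ := him₂ ⟨hsep.le, hlt.le⟩
    have e1 := hgv₂ t ht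
    have e2 := hgv₁ 0 (left_mem_Icc.2 hT₁.le)
    simp only at hteq e1 e2
    rw [hteq] at e1
    rw [e1, e2, hs₁]
    linarith [hnonneg₂ t ht]
  obtain ⟨x, hx, hx0⟩ := intermediate_value_Icc hsep.le hdiff ⟨hleft, hright⟩
  obtain ⟨t₁, ht₁, e₁⟩ := him₁ ⟨hcon.le.trans hx.1, hx.2⟩
  obtain ⟨t₂, ht₂, e₂⟩ := him₂ ⟨hx.1, hx.2.trans hlt.le⟩
  have f1 := hgv₁ t₁ ht₁
  have f2 := hgv₂ t₂ ht₂
  simp only at e₁ e₂ f1 f2 hx0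
  rw [e₁] at f1
  rw [e₂] at f2
  have hmeet : γ₁ t₁ = γ₂ t₂ := Prod.ext (by rw [e₁, e₂]) (by linarith)
  have hflow := solution_eq_of_eq hf h₁ h₂ hmeet
  rcases lt_trichotomy t₁ t₂ with h | h | h
  · have := hflow (-t₁)
    rw [neg_add_cancel] at this
    have hpos := hp₂ (-t₁ + t₂) ⟨by linarith, ?_⟩
    · rw [← this, hs₁] at hpos
      exact lt_irrefl _ hpos
    · rcases ht₁.1.eq_or_lt with h0 | h0
      · rcases ht₂.2.eq_or_lt with hT | hT
        · subst h0 hT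
          rw [hmeet] at hsep
          exact absurd hsep (lt_irrefl _)
        · linarith
      · linarith [ht₂.2]
  · have := hflow (-t₁)
    rw [neg_add_cancel, h, neg_add_cancel] at this
    rw [this] at hlt
    exact lt_irrefl _ hlt
  · have := hflow (-t₂)
    rw [neg_add_cancel] at this
    have hpos := hp₁ (-t₂ + t₁) ⟨by linarith, ?_⟩
    · rw [this, hs₂] at hpos
      exact lt_irrefl _ hpos
    · rcases ht₂.1.eq_or_lt with h0 | h0
      · rcases ht₁.2.eq_or_lt with hT | hT
        · subst h0 hT
          rw [hmeet] at hcon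
          exact absurd (hcon.trans (hsep.trans hlt)) (lt_irrefl _)
        · linarith
      · linarith [ht₁.2]

/-- The `y`-nullcline of the model, translated so that the equilibrium is the origin. -/
noncomputable def iceNullcline (β v : ℝ) : ℝ := v ^ 3 / 3 - β * v ^ 2 - (1 - β ^ 2) * v

theorem iceNullcline_neg (β v : ℝ) : iceNullcline (-β) (-v) = -iceNullcline β v := by
  unfold iceNullcline; ring

theorem abs_iceNullcline_le {β v M : ℝ} (hβ : |β| < 1) (hv : 0 ≤ v) (hvM : v ≤ M) :
    |iceNullcline β v| ≤ v * (M ^ 2 + M + 1) := by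
  obtain ⟨h1, h2⟩ := abs_lt.1 hβ
  have hF : iceNullcline β v = v * (v ^ 2 / 3 - β * v - (1 - β ^ 2)) := by
    unfold iceNullcline; ring
  rw [hF, abs_mul, abs_of_nonneg hv]
  refine mul_le_mul_of_nonneg_left (abs_le.2 ⟨?_, ?_⟩) hv <;>
    nlinarith [mul_nonneg hv (by linarith : 0 ≤ 1 - β), mul_nonneg hv (by linarith : 0 ≤ 1 + β)]

theorem exists_energy_growth {α β : ℝ} (hα : 0 < α) (hβ : |β| < 1) :
    ∃ ε₀ > 0, ε₀ ≤ 1 ∧ ∀ ε, 0 < ε → ε ≤ ε₀ → ∀ w v, 0 ≤ v →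
      w ^ 2 / 2 + v ^ 2 / (2 * α) < ε ^ 2 / 2 →
      |w| ≤ 1 ∧ |v| ≤ 1 ∧ 0 ≤ -(v * iceNullcline β v) := by
  obtain ⟨h1, h2⟩ := abs_lt.1 hβ
  set b := (1 - β ^ 2) / 2 with hb
  have hb0 : 0 < b := by nlinarith
  have hb1 : b ≤ 1 / 2 := by nlinarith [sq_nonneg β]
  refine ⟨min 1 (b / (1 + α)), by positivity, min_le_left _ _, fun ε hε hεle w v hv hE ↦ ?_⟩
  have hε1 : ε ≤ 1 := hεle.trans (min_le_left _ _)
  have hε2 : ε * (1 + α) ≤ b := (le_div_iff₀ (by positivity)).1 (hεle.trans (min_le_right _ _))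
  have hv2 : v ^ 2 < α * ε ^ 2 := by
    have : v ^ 2 / (2 * α) < ε ^ 2 / 2 := by nlinarith [sq_nonneg w]
    rw [div_lt_iff₀ (by positivity)] at this
    linarith
  have hw2 : w ^ 2 < ε ^ 2 := by
    have : 0 ≤ v ^ 2 / (2 * α) := by positivity
    linarith
  have hw1 : |w| ≤ ε := abs_le_of_sq_le_sq hw2.le hε.le
  have hvb : v ≤ b := by
    have : v ^ 2 ≤ b ^ 2 := by
      have : (ε * (1 + α)) ^ 2 ≤ b ^ 2 := by gcongr
      nlinarith [sq_nonneg ε, mul_pos hα hα, mul_nonneg (sq_nonneg ε) (sq_nonneg α),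
        mul_nonneg (sq_nonneg ε) hα.le]
    exact abs_le_of_sq_le_sq' this hb0.le |>.2
  refine ⟨hw1.trans hε1, by rw [abs_of_nonneg hv]; linarith, ?_⟩
  have : -(v * iceNullcline β v) = v ^ 2 * (2 * b - v ^ 2 / 3 + β * v) := by
    unfold iceNullcline; rw [hb]; ring
  rw [this]
  refine mul_nonneg (sq_nonneg v) ?_
  nlinarith [mul_nonneg hv (by linarith : 0 ≤ 1 + β)]

/-- A Lyapunov function for large orbits in the half-plane `0 ≤ v`. -/
noncomputable def iceLyapunov (α w v : ℝ) : ℝ :=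
  w ^ 2 / 2 + v ^ 2 / (2 * α) - w * v / (α * (1 + v))

theorem iceLyapunov_bounded {α R w v : ℝ} (hα : 0 < α) (hR : 0 ≤ R) (hv : 0 ≤ v)
    (h : iceLyapunov α w v ≤ R ^ 2 / 2) :
    |w| ≤ 2 / α + R + α * R ^ 2 + 1 ∧ |v| ≤ 2 / α + R + α * R ^ 2 + 1 := by
  have hfrac : w * v / (α * (1 + v)) ≤ |w| / α := by
    rw [div_le_div_iff₀ (by positivity) hα]
    have : w * v ≤ |w| * (1 + v) := by nlinarith [le_abs_self w, abs_nonneg w]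
    nlinarith
  set a := 1 / α with ha
  have ha0 : 0 < a := by positivity
  have haα : a * α = 1 := by rw [ha]; field_simp
  have h1 : |w| / α = |w| * a := by rw [ha]; ring
  have h2 : v ^ 2 / (2 * α) = v ^ 2 * a / 2 := by rw [ha]; field_simp
  have h3 : 2 / α = 2 * a := by rw [ha]; ring
  unfold iceLyapunov at h
  rw [h1] at hfrac
  rw [h2] at h
  rw [h3, abs_of_nonneg hv]
  have hw2 := sq_abs w
  have hmain : (|w| - a) ^ 2 + v ^ 2 * a ≤ R ^ 2 + a ^ 2 := by nlinarith
  have hαR : 0 ≤ α * R ^ 2 := by positivity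
  constructor
  · have : (|w| - a) ^ 2 ≤ (R + a) ^ 2 := by
      nlinarith [mul_nonneg (sq_nonneg v) ha0.le, mul_nonneg hR ha0.le]
    have := (abs_le_of_sq_le_sq' this (by positivity)).2
    linarith
  · have h4 : v ^ 2 * a ≤ R ^ 2 + a ^ 2 := by nlinarith [sq_nonneg (|w| - a)]
    have h5 : v ^ 2 ≤ α * R ^ 2 + a := by
      have := mul_le_mul_of_nonneg_right h4 hα.le
      have e1 : v ^ 2 * a * α = v ^ 2 := by rw [mul_assoc, haα, mul_one]
      have e2 : (R ^ 2 + a ^ 2) * α = α * R ^ 2 + a := by linear_combination a * haα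
      rwa [e1, e2] at this
    nlinarith [sq_nonneg (v - 1)]

theorem exists_lyapunov_decay {α β : ℝ} (hα : 0 < α) (hβ : |β| < 1) :
    ∃ R₀ ≥ 1, ∀ R ≥ R₀, ∀ w v, 0 ≤ v → iceLyapunov α w v = R ^ 2 / 2 →
      -(v * iceNullcline β v) + v ^ 2 / (α * (1 + v))
        - w * (w - iceNullcline β v) / (1 + v) ^ 2 < 0 := by
  obtain ⟨h1, h2⟩ := abs_lt.1 hβ
  obtain ⟨a, ha⟩ : ∃ x, x = 1 / α := ⟨_, rfl⟩
  have ha0 : 0 < a := by rw [ha]; positivity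
  obtain ⟨V, hV⟩ : ∃ x, x = 6 + 6 * a := ⟨_, rfl⟩
  obtain ⟨Q, hQ⟩ : ∃ x, x = V * (V ^ 2 + V + 1) := ⟨_, rfl⟩
  obtain ⟨S, hS⟩ : ∃ x, x = (V * Q + V ^ 2 * a + 1) * (1 + V) ^ 2 + Q * (1 + V) ^ 2 + 1 := ⟨_, rfl⟩
  have hV0 : 0 < V := by rw [hV]; positivity
  have hQ0 : 0 < Q := by rw [hQ]; positivity
  have hS0 : 1 ≤ S := by
    have : 0 ≤ (V * Q + V ^ 2 * a + 1) * (1 + V) ^ 2 + Q * (1 + V) ^ 2 := by positivity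
    linarith
  obtain ⟨B, hB⟩ : ∃ x, x = S ^ 2 / 2 + V ^ 2 * a / 2 + S * a := ⟨_, rfl⟩
  have hB0 : 0 < B := by rw [hB]; positivity
  refine ⟨1 + 2 * B, by linarith, fun R hR w v hv hL ↦ ?_⟩
  obtain ⟨F, hF⟩ : ∃ x, x = iceNullcline β v := ⟨_, rfl⟩
  rw [← hF]
  have hdiv : v ^ 2 / (α * (1 + v)) ≤ v ^ 2 * a := by
    rw [ha, mul_one_div]
    gcongr
    nlinarith
  rcases le_total V v with hVv | hvV
  · obtain ⟨q, hq⟩ : ∃ x, x = v ^ 2 / 3 - β * v - (1 - β ^ 2) := ⟨_, rfl⟩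
    have hFq : F = v * q := by rw [hF, hq]; unfold iceNullcline; ring
    have hv6 : 6 ≤ v := by linarith
    have hqlow : 2 * a < q := by
      have hvv : V * v ≤ v * v := mul_le_mul_of_nonneg_right hVv hv
      have hβv : β * v ≤ v := by nlinarith
      have : (6 + 6 * a) * v ≤ v ^ 2 := by rw [← hV]; nlinarith
      have hav : 6 * a ≤ a * v := by linarith [mul_le_mul_of_nonneg_left hv6 ha0.le]
      have hβ2 : 0 ≤ β ^ 2 := sq_nonneg β
      rw [hq]
      linarith
    have hqup : q ≤ (1 + v) ^ 2 := by
      have hβ2 : β ^ 2 ≤ 1 := by nlinarith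
      rw [hq]
      linarith [mul_nonneg hv (by linarith : 0 ≤ 1 + β), sq_nonneg v]
    have hquad : -(w * (w - F) / (1 + v) ^ 2) ≤ v ^ 2 * q / 4 := by
      rw [← neg_div, div_le_iff₀ (by positivity)]
      have hq0 : 0 ≤ q := by linarith
      have : v ^ 2 * q * q ≤ v ^ 2 * q * (1 + v) ^ 2 :=
        mul_le_mul_of_nonneg_left hqup (by positivity)
      rw [hFq]
      linarith [sq_nonneg (w - v * q / 2)]
    have hv2 : 0 < v ^ 2 := by positivity
    rw [hFq] at hquad ⊢
    linarith [mul_pos hv2 (by linarith : 0 < 3 * q / 4 - a)]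
  · have hFabs : |F| ≤ Q := by
      rw [hF, hQ]
      exact (abs_iceNullcline_le hβ hv hvV).trans (mul_le_mul_of_nonneg_right hvV (by positivity))
    have hwlarge : S < |w| := by
      by_contra! hcon
      have hR2 : B < R ^ 2 / 2 := by nlinarith
      have hfrac : -(w * v / (α * (1 + v))) ≤ S * a := by
        rw [← neg_div, ha, mul_one_div, div_le_div_iff₀ (by positivity) hα]
        have : -(w * v) ≤ S * (1 + v) := by nlinarith [neg_abs_le w]
        nlinarith
      have hvsq : v ^ 2 / (2 * α) ≤ V ^ 2 * a / 2 := by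
        have : V ^ 2 * a / 2 = V ^ 2 / (2 * α) := by rw [ha]; field_simp
        rw [this]
        gcongr
      have hwsq : w ^ 2 ≤ S ^ 2 := by rw [← sq_abs]; gcongr
      unfold iceLyapunov at hL
      linarith
    have hvF : -(v * F) ≤ V * Q := by
      have : |v * F| ≤ V * Q := by
        rw [abs_mul, abs_of_nonneg hv]; gcongr
      linarith [neg_abs_le (v * F)]
    have hva : v ^ 2 * a ≤ V ^ 2 * a := by gcongr
    have hwF : w * F ≤ |w| * Q := by
      calc w * F ≤ |w * F| := le_abs_self _
        _ = |w| * |F| := abs_mul _ _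
        _ ≤ _ := by gcongr
    have hprod : V * Q + V ^ 2 * a + 1 ≤ w * (w - F) / (1 + V) ^ 2 := by
      rw [le_div_iff₀ (by positivity)]
      have hA : 0 ≤ (V * Q + V ^ 2 * a + 1) * (1 + V) ^ 2 := by positivity
      have hQV : Q ≤ Q * (1 + V) ^ 2 :=
        le_mul_of_one_le_right hQ0.le (one_le_pow₀ (by linarith))
      have : (V * Q + V ^ 2 * a + 1) * (1 + V) ^ 2 ≤ |w| - Q := by linarith
      have hw1 : 1 * (|w| - Q) ≤ |w| * (|w| - Q) :=
        mul_le_mul_of_nonneg_right (by linarith) (by linarith)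
      linarith [sq_abs w]
    have hpos : 0 ≤ w * (w - F) := by
      by_contra! hneg
      have : w * (w - F) / (1 + V) ^ 2 < 0 := div_neg_of_neg_of_pos hneg (by positivity)
      have : 0 ≤ V * Q + V ^ 2 * a + 1 := by positivity
      linarith
    have hmono : w * (w - F) / (1 + V) ^ 2 ≤ w * (w - F) / (1 + v) ^ 2 := by gcongr
    linarith

theorem ice_half_orbit_trapped {α β ε R M : ℝ} (hα : 0 < α) (hR : 1 ≤ R)
    (hM : 2 / α + R + α * R ^ 2 + 1 ≤ M) (hε : 0 < ε)
    (hgrow : ∀ w v, 0 ≤ v → w ^ 2 / 2 + v ^ 2 / (2 * α) < ε ^ 2 / 2 →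
      |w| ≤ 1 ∧ |v| ≤ 1 ∧ 0 ≤ -(v * iceNullcline β v))
    (hdecay : ∀ w v, 0 ≤ v → iceLyapunov α w v = R ^ 2 / 2 →
      -(v * iceNullcline β v) + v ^ 2 / (α * (1 + v))
        - w * (w - iceNullcline β v) / (1 + v) ^ 2 < 0)
    {w v w' v' : ℝ → ℝ} (hw : ∀ t, HasDerivAt w (w' t) t) (hv : ∀ t, HasDerivAt v (v' t) t)
    (hbox : ∀ t, |w t| ≤ M → |v t| ≤ M →
      w' t = -v t ∧ v' t = α * (w t - iceNullcline β (v t)))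
    (hv0 : v 0 = 0) (hw0 : w 0 ∈ Icc ε R) {T : ℝ} (hpos : ∀ t ∈ Icc 0 T, 0 ≤ v t) :
    ∀ t ∈ Icc 0 T, iceLyapunov α (w t) (v t) ≤ R ^ 2 / 2 ∧ |w t| ≤ M ∧ |v t| ≤ M ∧
      ε ^ 2 / 2 ≤ w t ^ 2 / 2 + v t ^ 2 / (2 * α) := by
  have hbd : ∀ t ∈ Icc 0 T, iceLyapunov α (w t) (v t) ≤ R ^ 2 / 2 → |w t| ≤ M ∧ |v t| ≤ M := by
    intro t ht h
    obtain ⟨h1, h2⟩ := iceLyapunov_bounded hα (by linarith) (hpos t ht) h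
    exact ⟨h1.trans hM, h2.trans hM⟩
  have hL : ∀ t ∈ Icc 0 T, iceLyapunov α (w t) (v t) ≤ R ^ 2 / 2 := by
    refine le_of_deriv_neg_at_level (f := fun t ↦ iceLyapunov α (w t) (v t))
      (f' := fun t ↦ w t * w' t + v t * v' t / α
        - ((w' t * v t + w t * v' t) * (α * (1 + v t)) - w t * v t * (α * v' t))
          / (α * (1 + v t)) ^ 2) ?_ ?_ ?_
    · intro t ht
      have hne : α * (1 + v t) ≠ 0 := (mul_pos hα (by linarith [hpos t ht])).ne'
      have := ((((hw t).pow 2).div_const 2).add (((hv t).pow 2).div_const (2 * α))).sub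
        (((hw t).mul (hv t)).div (((hv t).const_add 1).const_mul α) hne)
      refine this.congr_deriv ?_
      simp
      field_simp
    · simp only [iceLyapunov, hv0]
      have : w 0 ^ 2 ≤ R ^ 2 := by
        have := hw0.1
        have := hw0.2
        gcongr
        linarith
      simp
      linarith
    · intro t ht heq
      obtain ⟨h1, h2⟩ := hbd t ht heq.le
      obtain ⟨e1, e2⟩ := hbox t h1 h2
      have hvt := hpos t ht
      have hd := hdecay (w t) (v t) hvt heq
      have hne : 1 + v t ≠ 0 := by positivity
      simp only [e1, e2]
      convert hd using 1
      field_simp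
      ring
  have hE : ∀ t ∈ Icc 0 T, ε ^ 2 / 2 ≤ w t ^ 2 / 2 + v t ^ 2 / (2 * α) := by
    refine ge_of_deriv_nonneg_below (f := fun t ↦ w t ^ 2 / 2 + v t ^ 2 / (2 * α))
      (f' := fun t ↦ w t * w' t + v t * v' t / α) ?_ ?_ ?_
    · intro t ht
      have := (((hw t).pow 2).div_const 2).add (((hv t).pow 2).div_const (2 * α))
      refine this.congr_deriv ?_
      simp
      field_simp
    · have := hw0.1
      simp only [hv0]
      have : ε ^ 2 ≤ w 0 ^ 2 := by gcongr
      simp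
      linarith
    · intro t ht hlt
      have h1M : 1 ≤ M := by
        have : 0 ≤ 2 / α + α * R ^ 2 := by positivity
        linarith
      obtain ⟨h1, h2, h3⟩ := hgrow _ _ (hpos t ht) hlt
      obtain ⟨e1, e2⟩ := hbox t (h1.trans h1M) (h2.trans h1M)
      simp only [e1, e2]
      convert h3 using 1
      field_simp
      ring
  exact fun t ht ↦ ⟨hL t ht, (hbd t ht (hL t ht)).1, (hbd t ht (hL t ht)).2, hE t ht⟩

theorem ice_half_orbit_returns {α β ε M : ℝ} (hα : 0 < α) (hβ : |β| < 1) (hε : 0 < ε)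
    (hM : 1 ≤ M) {w v : ℝ → ℝ}
    (hw : ∀ t ≥ 0, HasDerivAt w (-v t) t)
    (hv : ∀ t ≥ 0, HasDerivAt v (α * (w t - iceNullcline β (v t))) t)
    (hpos : ∀ t ≥ 0, 0 ≤ v t) (hwM : ∀ t ≥ 0, |w t| ≤ M) (hvM : ∀ t ≥ 0, |v t| ≤ M)
    (hE : ∀ t ≥ 0, ε ^ 2 / 2 ≤ w t ^ 2 / 2 + v t ^ 2 / (2 * α)) : False := by
  obtain ⟨Q, hQ⟩ : ∃ x, x = M ^ 2 + M + 1 := ⟨_, rfl⟩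
  have hQ0 : 0 < Q := by rw [hQ]; positivity
  obtain ⟨κ, hκ⟩ : ∃ x, x = 1 / (2 * (M + α * M * Q)) := ⟨_, rfl⟩
  have hκ0 : 0 < κ := by rw [hκ]; positivity
  have hκ1 : κ * (M + α * M * Q) = 1 / 2 := by rw [hκ]; field_simp
  obtain ⟨c, hc⟩ : ∃ x, x = min (α / M) (2 * κ * α) := ⟨_, rfl⟩
  have hc0 : 0 < c := by rw [hc]; positivity
  have hcM : c * M ≤ α := by
    rw [← le_div_iff₀ (by positivity), hc]; exact min_le_left _ _
  have hcκ : c ≤ 2 * κ * α := by rw [hc]; exact min_le_right _ _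
  have hder : ∀ t ≥ 0, HasDerivAt (fun t ↦ w t - κ * (w t * v t) + c * (ε ^ 2 / 2) * t)
      (-v t - κ * (-v t * v t + w t * (α * (w t - iceNullcline β (v t)))) + c * (ε ^ 2 / 2)) t := by
    intro t ht
    exact (((hw t ht).sub (((hw t ht).mul (hv t ht)).const_mul κ)).add
      ((hasDerivAt_id t).const_mul (c * (ε ^ 2 / 2)))).congr_deriv (by simp)
  have hanti : AntitoneOn (fun t ↦ w t - κ * (w t * v t) + c * (ε ^ 2 / 2) * t) (Ici 0) := by
    refine antitoneOn_of_hasDerivWithinAt_nonpos (convex_Ici 0)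
      (fun t ht ↦ (hder t ht).continuousAt.continuousWithinAt)
      (fun t ht ↦ (hder t (interior_subset ht)).hasDerivWithinAt) ?_
    intro t ht
    replace ht : t ≥ 0 := interior_subset ht
    have h1 := hpos t ht
    have h2 := hwM t ht
    have h3 : v t ≤ M := (le_abs_self _).trans (hvM t ht)
    have h4 := abs_iceNullcline_le hβ h1 h3
    rw [← hQ] at h4
    have h5 := hE t ht
    have hwF : w t * iceNullcline β (v t) ≤ M * (v t * Q) := by
      calc _ ≤ |w t * iceNullcline β (v t)| := le_abs_self _
        _ = |w t| * |iceNullcline β (v t)| := abs_mul _ _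
        _ ≤ _ := by gcongr
    have hvv : v t * v t ≤ v t * M := by gcongr
    have h6 : κ * (v t * v t + α * (w t * iceNullcline β (v t))) ≤ v t / 2 := by
      calc _ ≤ κ * (v t * M + α * (M * (v t * Q))) := by gcongr
        _ = v t * (κ * (M + α * M * Q)) := by ring
        _ = _ := by rw [hκ1]; ring
    have h7 : c * (ε ^ 2 / 2) ≤ c * (w t ^ 2 / 2 + v t ^ 2 / (2 * α)) := by gcongr
    have h8 : c * (w t ^ 2 / 2) ≤ κ * α * w t ^ 2 := by nlinarith [sq_nonneg (w t)]
    have h9 : c * (v t ^ 2 / (2 * α)) ≤ v t / 2 := by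
      rw [mul_div_assoc', div_le_iff₀ (by positivity)]
      calc c * v t ^ 2 = c * (v t * v t) := by ring
        _ ≤ c * (v t * M) := by gcongr
        _ = (c * M) * v t := by ring
        _ ≤ α * v t := by gcongr
        _ = _ := by ring
    linarith
  obtain ⟨D, hD⟩ : ∃ x, x = M + κ * (M * M) := ⟨_, rfl⟩
  have hbound : ∀ t ≥ 0, |w t - κ * (w t * v t)| ≤ D := by
    intro t ht
    calc _ ≤ |w t| + |κ * (w t * v t)| := abs_sub _ _
      _ = |w t| + κ * (|w t| * |v t|) := by rw [abs_mul, abs_mul, abs_of_pos hκ0]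
      _ ≤ D := by
        rw [hD]
        have := hwM t ht
        have := hvM t ht
        gcongr
  have hD0 : 0 ≤ D := by rw [hD]; positivity
  obtain ⟨t, ht⟩ : ∃ x, x = (2 * D + 1) / (c * (ε ^ 2 / 2)) := ⟨_, rfl⟩
  have ht0 : t ≥ 0 := by rw [ht]; positivity
  have htv : c * (ε ^ 2 / 2) * t = 2 * D + 1 := by rw [ht]; field_simp
  have := hanti (mem_Ici.2 le_rfl) (mem_Ici.2 ht0) ht0
  simp only at this
  rw [htv] at this
  have a1 := abs_le.1 (hbound 0 le_rfl)
  have a2 := abs_le.1 (hbound t ht0)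
  linarith

theorem exists_ice_half_orbit {α β : ℝ} (hα : 0 < α) (hβ : |β| < 1) :
    ∃ ε₀ > 0, ∃ R₀ ≥ 1, ε₀ ≤ 1 ∧ ∀ ε R M, 0 < ε → ε ≤ ε₀ → R₀ ≤ R →
      2 / α + R + α * R ^ 2 + 1 ≤ M → ∀ w v w' v' : ℝ → ℝ,
      (∀ t, HasDerivAt w (w' t) t) → (∀ t, HasDerivAt v (v' t) t) →
      (∀ t, |w t| ≤ M → |v t| ≤ M →
        w' t = -v t ∧ v' t = α * (w t - iceNullcline β (v t))) →
      v 0 = 0 → w 0 ∈ Icc ε R →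
      ∃ T > 0, v T = 0 ∧ w T ∈ Icc (-R) (-ε) ∧ (∀ t ∈ Ioo 0 T, 0 < v t) ∧
        (∀ t ∈ Icc 0 T, |w t| ≤ M ∧ |v t| ≤ M) ∧ StrictAntiOn w (Icc 0 T) := by
  obtain ⟨ε₀, hε₀, hε₁, hgrow⟩ := exists_energy_growth hα hβ
  obtain ⟨R₀, hR₀, hdecay⟩ := exists_lyapunov_decay hα hβ
  refine ⟨ε₀, hε₀, R₀, hR₀, hε₁, fun ε R M hε hεle hR hM w v w' v' hw hv hbox hv0 hw0 ↦ ?_⟩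
  have hR1 : 1 ≤ R := hR₀.trans hR
  have htrap := fun T : ℝ ↦ ice_half_orbit_trapped hα hR1 hM hε (hgrow ε hε hεle)
    (hdecay R hR) hw hv hbox hv0 hw0 (T := T)
  have hM1 : 1 ≤ M := by
    have : 0 ≤ 2 / α + α * R ^ 2 := by positivity
    linarith
  have hcv : Continuous v := continuous_iff_continuousAt.2 fun t ↦ (hv t).continuousAt
  have hcw : Continuous w := continuous_iff_continuousAt.2 fun t ↦ (hw t).continuousAt
  have hv'0 : 0 < v' 0 := by
    have h := htrap 0 (fun t ht ↦ by rw [le_antisymm ht.2 ht.1, hv0]) 0 ⟨le_rfl, le_rfl⟩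
    rw [(hbox 0 h.2.1 h.2.2.1).2, hv0]
    have : 0 < w 0 := hε.trans_le hw0.1
    simp [iceNullcline]
    positivity
  obtain ⟨δ, hδ, hδpos⟩ : ∃ δ > 0, ∀ t ∈ Ioo 0 δ, 0 < v t := by
    have h1 : ∀ᶠ t in 𝓝[>] (0 : ℝ), 0 < slope v 0 t :=
      ((hasDerivAt_iff_tendsto_slope.1 (hv 0)).mono_left
        (nhdsWithin_mono _ fun t ht ↦ (ne_of_gt ht))).eventually (lt_mem_nhds hv'0)
    obtain ⟨δ, hδ, h⟩ := (mem_nhdsGT_iff_exists_Ioo_subset).1 h1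
    refine ⟨δ, hδ, fun t ht ↦ ?_⟩
    have := h ht
    simp only [mem_ofPred_eq, slope_def_field, hv0, sub_zero] at this
    exact (div_pos_iff_of_pos_right ht.1).1 this
  have hret : ∃ t > 0, v t ≤ 0 := by
    by_contra! hcon
    have hnn : ∀ t ≥ 0, 0 ≤ v t := fun t ht ↦ by
      rcases ht.eq_or_lt with h | h
      · rw [← h, hv0]
      · exact (hcon t h).le
    have htr := fun t (ht : t ≥ 0) ↦ htrap t (fun s hs ↦ hnn s hs.1) t ⟨ht, le_rfl⟩
    refine ice_half_orbit_returns hα hβ hε hM1 (w := w) (v := v) (fun t ht ↦ ?_) (fun t ht ↦ ?_)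
      hnn (fun t ht ↦ (htr t ht).2.1) (fun t ht ↦ (htr t ht).2.2.1) fun t ht ↦ (htr t ht).2.2.2
    · rw [← (hbox t (htr t ht).2.1 (htr t ht).2.2.1).1]; exact hw t
    · rw [← (hbox t (htr t ht).2.1 (htr t ht).2.2.1).2]; exact hv t
  obtain ⟨t₀, ht₀, hvt₀⟩ := hret
  set Z := {t | δ / 2 ≤ t ∧ v t ≤ 0} with hZ
  have hZcl : IsClosed Z :=
    (isClosed_le continuous_const continuous_id).inter (isClosed_le hcv continuous_const)
  have hZne : Z.Nonempty := by
    refine ⟨t₀, ?_, hvt₀⟩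
    by_contra! hlt
    exact (hδpos t₀ ⟨ht₀, by linarith⟩).not_ge hvt₀
  have hZbdd : BddBelow Z := ⟨δ / 2, fun t ht ↦ ht.1⟩
  set T := sInf Z with hT
  have hTZ : T ∈ Z := hZcl.csInf_mem hZne hZbdd
  have hT0 : 0 < T := by linarith [hTZ.1]
  have hpos : ∀ t ∈ Ioo 0 T, 0 < v t := by
    intro t ht
    by_contra! hle
    rcases lt_or_ge t (δ / 2) with h | h
    · exact (hδpos t ⟨ht.1, by linarith⟩).not_ge hle
    · exact (csInf_le hZbdd ⟨h, hle⟩).not_gt ht.2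
  have hvT : v T = 0 := by
    refine le_antisymm hTZ.2 ?_
    refine ge_of_tendsto (hcv.continuousAt.mono_left nhdsWithin_le_nhds : Tendsto v (𝓝[<] T) _) ?_
    filter_upwards [Ioo_mem_nhdsLT hT0] with t ht using (hpos t ht).le
  have hnn : ∀ t ∈ Icc 0 T, 0 ≤ v t := by
    intro t ht
    rcases ht.1.eq_or_lt with h | h
    · rw [← h, hv0]
    rcases ht.2.eq_or_lt with h' | h'
    · rw [h', hvT]
    · exact (hpos t ⟨h, h'⟩).le
  have htr := htrap T hnn
  have hbx : ∀ t ∈ Icc 0 T, |w t| ≤ M ∧ |v t| ≤ M := fun t ht ↦ ⟨(htr t ht).2.1, (htr t ht).2.2.1⟩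
  have hTmem : T ∈ Icc 0 T := ⟨hT0.le, le_rfl⟩
  have hv'T : v' T ≤ 0 := by
    have h1 : Tendsto (slope v T) (𝓝[<] T) (𝓝 (v' T)) :=
      (hasDerivAt_iff_tendsto_slope.1 (hv T)).mono_left (nhdsWithin_mono _ fun t ht ↦ (ne_of_lt ht))
    refine le_of_tendsto h1 ?_
    filter_upwards [Ioo_mem_nhdsLT hT0] with t ht
    rw [slope_def_field, hvT, sub_zero]
    exact div_nonpos_of_nonneg_of_nonpos (hpos t ht).le (by linarith [ht.2])
  rw [(hbox T (hbx T hTmem).1 (hbx T hTmem).2).2, hvT] at hv'T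
  have hwT : w T ≤ 0 := by
    have : α * w T ≤ 0 := by simpa [iceNullcline] using hv'T
    exact nonpos_of_mul_nonpos_right this hα
  obtain ⟨hLT, -, -, hET⟩ := htr T hTmem
  simp only [iceLyapunov, hvT] at hLT hET
  refine ⟨T, hT0, hvT, ⟨?_, ?_⟩, hpos, hbx, ?_⟩
  · have : w T ^ 2 ≤ R ^ 2 := by
      simp at hLT
      linarith
    exact (abs_le_of_sq_le_sq' this (by linarith)).1
  · have hsq : ε ^ 2 ≤ (-w T) ^ 2 := by
      simp at hET
      linarith [neg_sq (w T)]
    linarith [abs_le_of_sq_le_sq hsq (by linarith : 0 ≤ -w T), le_abs_self ε]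
  · refine strictAntiOn_of_hasDerivWithinAt_neg (convex_Icc 0 T) hcw.continuousOn
      (fun t _ ↦ (hw t).hasDerivWithinAt) ?_
    intro t ht
    rw [interior_Icc] at ht
    obtain ⟨h1, h2⟩ := hbx t (Ioo_subset_Icc_self ht)
    rw [(hbox t h1 h2).1]
    linarith [hpos t ht]

/-- The translated unit-time-scale ice-age vector field, with both coordinates truncated to
`[-M, M]` so that it is bounded and Lipschitz. -/
noncomputable def iceField (α β M : ℝ) (p : ℝ × ℝ) : ℝ × ℝ :=
  (-max (-M) (min M p.2),
    α * (max (-M) (min M p.1) - iceNullcline β (max (-M) (min M p.2))))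

theorem iceField_of_abs_le {α β M : ℝ} {p : ℝ × ℝ} (h₁ : |p.1| ≤ M) (h₂ : |p.2| ≤ M) :
    iceField α β M p = (-p.2, α * (p.1 - iceNullcline β p.2)) := by
  rw [abs_le] at h₁ h₂
  simp [iceField, min_eq_right h₁.2, min_eq_right h₂.2, max_eq_right h₁.1, max_eq_right h₂.1]

theorem abs_truncate_le {M : ℝ} (hM : 0 ≤ M) (s : ℝ) : |max (-M) (min M s)| ≤ M :=
  abs_le.2 ⟨le_max_left _ _, max_le (by linarith) (min_le_left _ _)⟩

theorem truncate_neg {M : ℝ} (hM : 0 ≤ M) (s : ℝ) :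
    max (-M) (min M (-s)) = -max (-M) (min M s) := by
  grind

theorem iceField_neg {α β M : ℝ} (hM : 0 ≤ M) (p : ℝ × ℝ) :
    iceField α (-β) M (-p) = -iceField α β M p := by
  ext
  · simp only [iceField, Prod.fst_neg, Prod.snd_neg, truncate_neg hM]
  · simp only [iceField, Prod.fst_neg, Prod.snd_neg, truncate_neg hM, iceNullcline_neg]
    ring

theorem exists_iceNullcline_lipschitz (β : ℝ) {M : ℝ} (hM : 0 ≤ M) :
    ∃ K : ℝ≥0, ∀ a b, |a| ≤ M → |b| ≤ M →
      |iceNullcline β a - iceNullcline β b| ≤ K * |a - b| := by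
  refine ⟨(M ^ 2 + |β| * (2 * M) + (1 + β ^ 2)).toNNReal, fun a b ha hb ↦ ?_⟩
  have h : iceNullcline β a - iceNullcline β b
      = ((a ^ 2 + a * b + b ^ 2) / 3 - β * (a + b) - (1 - β ^ 2)) * (a - b) := by
    unfold iceNullcline; ring
  rw [h, abs_mul, Real.coe_toNNReal _ (by positivity)]
  refine mul_le_mul_of_nonneg_right ?_ (abs_nonneg _)
  have h1 : |β * (a + b)| ≤ |β| * (2 * M) := by
    rw [abs_mul]
    gcongr
    linarith [abs_add_le a b]
  have ha2 : a ^ 2 ≤ M ^ 2 := by rw [← sq_abs]; gcongr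
  have hb2 : b ^ 2 ≤ M ^ 2 := by rw [← sq_abs]; gcongr
  obtain ⟨h2, h3⟩ := abs_le.1 h1
  refine abs_le.2 ⟨?_, ?_⟩ <;>
    nlinarith [sq_nonneg (a + b), sq_nonneg (a - b), sq_nonneg β]

theorem exists_iceField_lipschitz_bounded (α β : ℝ) {M : ℝ} (hM : 0 ≤ M) :
    ∃ K C : ℝ≥0, LipschitzWith K (iceField α β M) ∧ ∀ p, ‖iceField α β M p‖ ≤ C := by
  obtain ⟨K, hK⟩ := exists_iceNullcline_lipschitz β hM
  have h1 : LipschitzWith 1 fun p : ℝ × ℝ ↦ max (-M) (min M p.1) :=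
    (LipschitzWith.prod_fst.const_min M).const_max (-M)
  have h2 : LipschitzWith 1 fun p : ℝ × ℝ ↦ max (-M) (min M p.2) :=
    (LipschitzWith.prod_snd.const_min M).const_max (-M)
  have h3 : LipschitzWith K fun p : ℝ × ℝ ↦ iceNullcline β (max (-M) (min M p.2)) := by
    refine LipschitzWith.of_dist_le_mul fun p q ↦ ?_
    rw [Real.dist_eq]
    refine (hK _ _ (abs_truncate_le hM _) (abs_truncate_le hM _)).trans ?_
    have := h2.dist_le_mul p q
    rw [Real.dist_eq, NNReal.coe_one, one_mul] at this
    gcongr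
  refine ⟨max 1 (‖α‖₊ * (1 + K)), max M.toNNReal (‖α‖₊ * (M.toNNReal + K * M.toNNReal)),
    h2.neg.prodMk ((lipschitzWith_smul α).comp (h1.sub h3)), fun p ↦ ?_⟩
  rw [Prod.norm_def, NNReal.coe_max, NNReal.coe_mul, NNReal.coe_add, NNReal.coe_mul, coe_nnnorm,
    Real.coe_toNNReal M hM]
  refine max_le_max ?_ ?_
  · rw [Real.norm_eq_abs]
    simpa [iceField] using abs_truncate_le hM p.2
  · have h4 := abs_truncate_le hM p.1
    have h5 := abs_truncate_le hM p.2
    have h6 := hK (max (-M) (min M p.2)) 0 h5 (by simpa using hM)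
    have h7 : iceNullcline β 0 = 0 := by simp [iceNullcline]
    rw [h7, sub_zero, sub_zero] at h6
    simp only [iceField, Real.norm_eq_abs, abs_mul]
    gcongr
    refine (abs_sub _ _).trans (add_le_add h4 (h6.trans ?_))
    gcongr

theorem exists_ice_half_return_map {α β : ℝ} (hα : 0 < α) (hβ : |β| < 1) :
    ∃ ε₀ > 0, ∃ R₀ ≥ 1, ε₀ ≤ 1 ∧ ∀ ε R M, 0 < ε → ε ≤ ε₀ → R₀ ≤ R →
      2 / α + R + α * R ^ 2 + 1 ≤ M →
      ∃ A : ℝ → ℝ, MapsTo A (Icc ε R) (Icc ε R) ∧ MonotoneOn A (Icc ε R) ∧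
        ∀ x ∈ Icc ε R, ∀ γ : ℝ → ℝ × ℝ, γ 0 = (x, 0) →
          (∀ t, HasDerivAt γ (iceField α β M (γ t)) t) →
          ∃ T > 0, γ T = (-A x, 0) ∧ ∀ t ∈ Icc 0 T, |(γ t).1| ≤ M ∧ |(γ t).2| ≤ M := by
  obtain ⟨ε₀, hε₀, R₀, hR₀, hε₁, hhalf⟩ := exists_ice_half_orbit hα hβ
  refine ⟨ε₀, hε₀, R₀, hR₀, hε₁, fun ε R M hε hεle hR hM ↦ ?_⟩
  have hM0 : 0 ≤ M := by
    have : 0 ≤ 2 / α + α * R ^ 2 := by positivity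
    linarith
  obtain ⟨K, C, hLip, hC⟩ := exists_iceField_lipschitz_bounded α β hM0
  choose Γ hΓ0 hΓ using fun x : ℝ ↦ exists_global_solution hLip hC (x, 0)
  have hret : ∀ x, ∃ T, x ∈ Icc ε R → 0 < T ∧ (Γ x T).2 = 0 ∧ (Γ x T).1 ∈ Icc (-R) (-ε) ∧
      (∀ t ∈ Ioo 0 T, 0 < (Γ x t).2) ∧ (∀ t ∈ Icc 0 T, |(Γ x t).1| ≤ M ∧ |(Γ x t).2| ≤ M) ∧
      StrictAntiOn (fun t ↦ (Γ x t).1) (Icc 0 T) := by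
    intro x
    by_cases hx : x ∈ Icc ε R
    · obtain ⟨T, h⟩ := hhalf ε R M hε hεle hR hM (fun t ↦ (Γ x t).1) (fun t ↦ (Γ x t).2) _ _
        (fun t ↦ (hΓ x t).fst) (fun t ↦ (hΓ x t).snd)
        (fun t h1 h2 ↦ by rw [iceField_of_abs_le h1 h2]; exact ⟨rfl, rfl⟩)
        (by simp [hΓ0]) (by simpa [hΓ0] using hx)
      exact ⟨T, fun _ ↦ h⟩
    · exact ⟨0, fun h ↦ absurd h hx⟩
  choose T hT using hret
  refine ⟨fun x ↦ -(Γ x (T x)).1, fun x hx ↦ ?_, fun x hx y hy hxy ↦ ?_, fun x hx γ h0 hγ ↦ ?_⟩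
  · obtain ⟨h1, h2⟩ := (hT x hx).2.2.1
    exact ⟨by linarith, by linarith⟩
  · rcases hxy.eq_or_lt with rfl | hlt
    · exact le_rfl
    obtain ⟨hTx, hex, -, hpx, -, hax⟩ := hT x hx
    obtain ⟨hTy, hey, hIy, hpy, -, hay⟩ := hT y hy
    refine neg_le_neg (half_orbit_endpoint_antitone hLip (hΓ x) (hΓ y) hTx hTy (by simp [hΓ0])
      (by simp [hΓ0]) hex hey hpx hpy hax hay (by simpa [hΓ0] using hlt) ?_)
    simp only [hΓ0]
    linarith [hIy.2, hx.1]
  · obtain ⟨hTx, hex, -, -, hbx, -⟩ := hT x hx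
    have heq : ∀ t, γ t = Γ x t := fun t ↦ by
      simpa using solution_eq_of_eq hLip hγ (hΓ x) (h0.trans (hΓ0 x).symm) t
    refine ⟨T x, hTx, ?_, fun t ht ↦ by rw [heq]; exact hbx t ht⟩
    rw [heq]
    exact Prod.ext (by simp) hex

theorem exists_normalized_ice_periodic_orbit {α β : ℝ} (hα : 0 < α) (hβ : |β| < 1) :
    ∃ T > 0, ∃ γ : ℝ → ℝ × ℝ, Function.Periodic γ T ∧ (∃ t₁ t₂, γ t₁ ≠ γ t₂) ∧
      ∀ t, HasDerivAt γ (-(γ t).2, α * ((γ t).1 - iceNullcline β (γ t).2)) t := by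
  obtain ⟨ε₁, hε₁, R₁, hR₁, hε₁', h₁⟩ := exists_ice_half_return_map hα hβ
  obtain ⟨ε₂, hε₂, R₂, hR₂, -, h₂⟩ :=
    exists_ice_half_return_map hα (show |-β| < 1 by rwa [abs_neg])
  set ε := min ε₁ ε₂
  set R := max R₁ R₂
  have hε : 0 < ε := lt_min hε₁ hε₂
  have hεR : ε ≤ R := (min_le_left _ _).trans (hε₁'.trans (hR₁.trans (le_max_left _ _)))
  obtain ⟨M, hM⟩ : ∃ M, 2 / α + R + α * R ^ 2 + 1 ≤ M := ⟨_, le_rfl⟩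
  have hM0 : 0 ≤ M := by
    have : 0 ≤ 2 / α + α * R ^ 2 := by positivity
    linarith
  obtain ⟨A, hAm, hA, hAr⟩ := h₁ ε R M hε (min_le_left _ _) (le_max_left _ _) hM
  obtain ⟨B, hBm, hB, hBr⟩ := h₂ ε R M hε (min_le_right _ _) (le_max_right _ _) hM
  obtain ⟨x, hx, hfix⟩ := MonotoneOn.exists_fixedPoint_Icc hεR (hB.comp hA hAm) (hBm.comp hAm)
  obtain ⟨K, C, hLip, hC⟩ := exists_iceField_lipschitz_bounded α β hM0
  obtain ⟨γ, h0, hγ⟩ := exists_global_solution hLip hC (x, 0)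
  obtain ⟨T₁, hT₁, hγT₁, hbox₁⟩ := hAr x hx γ h0 hγ
  obtain ⟨T₂, hT₂, hγT₂, hbox₂⟩ := hBr (A x) (hAm hx) (fun t ↦ -γ (t + T₁))
    (by simp [hγT₁]) (fun t ↦ by
      rw [iceField_neg hM0]
      exact ((hγ _).comp_add_const t T₁).neg)
  have hper : Function.Periodic γ (T₂ + T₁) := by
    have hret : γ (T₂ + T₁) = γ 0 := by
      rw [h0, ← neg_neg (γ (T₂ + T₁)), hγT₂]
      simpa using hfix
    intro t
    simpa using solution_eq_of_eq hLip hγ hγ hret t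
  have hbox : ∀ t, |(γ t).1| ≤ M ∧ |(γ t).2| ≤ M := by
    intro t
    obtain ⟨s, hs, hts⟩ := hper.exists_mem_Ico₀ (by linarith) t
    rw [hts]
    rcases le_total s T₁ with h | h
    · exact hbox₁ s ⟨hs.1, h⟩
    · simpa using hbox₂ (s - T₁) ⟨by linarith, by linarith [hs.2]⟩
  refine ⟨T₂ + T₁, by linarith, γ, hper, ⟨0, T₁, ?_⟩, fun t ↦ ?_⟩
  · rw [h0, hγT₁]
    intro h
    have h1 := (Prod.mk.inj h).1
    linarith [hx.1, (hAm hx).1]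
  · rw [← iceField_of_abs_le (hbox t).1 (hbox t).2]
    exact hγ t

/-- For `α > 0`, `τ > 0`, `|β| < 1`, the unforced ice-age model
`τ·x' = -(y + β)`, `τ·y' = -α·(y³/3 - y - x)` admits a nonconstant periodic
solution. -/
theorem ice_age_periodic_orbit
    (α β τ : ℝ) (hα : 0 < α) (hτ : 0 < τ) (hβ : |β| < 1) :
    ∃ T : ℝ, 0 < T ∧ ∃ xy : ℝ → ℝ × ℝ, Differentiable ℝ xy ∧
      Function.Periodic xy T ∧ (∃ t₁ t₂, xy t₁ ≠ xy t₂) ∧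
      ∀ t, τ * (deriv xy t).1 = -((xy t).2 + β) ∧
        τ * (deriv xy t).2 = -(α * ((xy t).2 ^ 3 / 3 - (xy t).2 - (xy t).1)) := by
  obtain ⟨T, hT, γ, hper, ⟨t₁, t₂, hne⟩, hγ⟩ := exists_normalized_ice_periodic_orbit hα hβ
  have hder : ∀ t, HasDerivAt (fun t ↦ γ (t / τ) + (β - β ^ 3 / 3, -β))
      ((1 / τ) • (-(γ (t / τ)).2, α * ((γ (t / τ)).1 - iceNullcline β (γ (t / τ)).2))) t :=
    fun t ↦ ((hγ (t / τ)).scomp t ((hasDerivAt_id t).div_const τ)).add_const _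
  refine ⟨T * τ, by positivity, fun t ↦ γ (t / τ) + (β - β ^ 3 / 3, -β),
    fun t ↦ (hder t).differentiableAt, fun t ↦ ?_, ⟨t₁ * τ, t₂ * τ, ?_⟩, fun t ↦ ?_⟩
  · have : (t + T * τ) / τ = t / τ + T := by field_simp
    simp only [this, hper (t / τ)]
  · simpa [hτ.ne'] using hne
  · rw [(hder t).deriv]
    simp only [Prod.smul_fst, Prod.smul_snd, Prod.fst_add, Prod.snd_add, smul_eq_mul, iceNullcline]
    constructor
    · field_simp
      ring
    · field_simp
      ring
end
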